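/- Let a_n be the coefficient of q^n in ∏_{m=1}^∞ (1 - q^m)^{14}. Let f : ℕ → ℂ be the multiplicative arithmetic function determined on prime powers as follows. For p ≡ 5 (mod 12): f(p^r) = (−1)^{r/2} p^{3r} if r is even and 0 if r is odd. For p ≡ 11 (mod 12): f(p^r) = p^{3r} if r is even and 0 if r is odd; f(2^r) = f(3^r) = 0 for all r ≥ 1. For p ≡ 7 (mod 12): writing (x, y) for the unique pair of positive integers with p = x^2 + 3y^2, f(p) = 12·(−1)^{(p−7)/12}·ψ(x,y)·x·y·(x^2 − y^2)·(9y^2 − x^2)·√3·i, where ψ(x,y) = −1 if either (x ≡ 2 (mod 6) and y ≢ 1 (mod 4)) or (x ≢ 2 (mod 6) and y ≡ 1 (mod 4)), and ψ(x,y) = 1 otherwise; and for r ≥ 2, f(p^r) = f(p)·f(p^{r−1}) + p^6·f(p^{r−2}). For p ≡ 1 (mod 12): with (x, y) as above, f(p) = 2·ω(x,y)·(x^2 − 3y^2)·(6xy + x^2 − 3y^2)·(6xy + 3y^2 − x^2), where ω(x,y) = (−1)^{y/2} if x ≡ 5 or 7 (mod 12) and ω(x,y) = (−1)^{y/2 +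 1} otherwise; and for r ≥ 2, f(p^r) = f(p)·f(p^{r−1}) − p^6·f(p^{r−2}). Then f(12n + 7) = 360·√3·i·a_n for all n ≥ 0. -/

import Mathlib

/-- The nontrivial quadratic character modulo `3`. -/
def chiThree (n : ZMod 3) : ℤ := ![0, 1, -1] n

/-- The character modulo `4` on elements `x + y√-3` of odd norm. -/
def kappaFour (x y : ZMod 4) : ℤ :=
  !![0, -1, 0, 1; 1, 0, -1, 0; 0, 1, 0, -1; -1, 0, 1, 0] x y

/-- The quadratic character of `ℤ[√-3]` entering the Hecke character. -/
def heckeChi (x y : ℤ) : ℤ := chiThree x * kappaFour x y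

theorem chiThree_mul : ∀ m n : ZMod 3, chiThree (m * n) = chiThree m * chiThree n := by decide

theorem kappaFour_mul : ∀ x y z w : ZMod 4,
    kappaFour (x * z - 3 * y * w) (x * w + y * z) = kappaFour x y * kappaFour z w := by decide

theorem heckeChi_mul (x y z w : ℤ) :
    heckeChi (x * z - 3 * y * w) (x * w + y * z) = heckeChi x y * heckeChi z w := by
  have h3 : ((x * z - 3 * y * w : ℤ) : ZMod 3) = (x : ZMod 3) * z := by
    push_cast
    have : (3 : ZMod 3) = 0 := rfl
    rw [this]; ring
  have h := kappaFour_mul x y z w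
  unfold heckeChi
  rw [h3, chiThree_mul]
  push_cast
  rw [h]; ring

/-- The number `√-3`. -/
noncomputable def rootNegThree : ℂ := Real.sqrt 3 * Complex.I

theorem rootNegThree_sq : rootNegThree ^ 2 = -3 := by
  have : ((Real.sqrt 3 : ℝ) : ℂ) ^ 2 = 3 := by
    rw [← Complex.ofReal_pow, Real.sq_sqrt (by norm_num)]; norm_num
  rw [rootNegThree, mul_pow, this, Complex.I_sq]; norm_num

/-- The Hecke character of weight `6`, on `x + y√-3`. -/
noncomputable def heckePsi (v : ℤ × ℤ) : ℂ :=
  heckeChi v.1 v.2 * ((v.1 : ℂ) + v.2 * rootNegThree) ^ 6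

/-- Multiplication in `ℤ[√-3]`. -/
def rootMul (v w : ℤ × ℤ) : ℤ × ℤ := (v.1 * w.1 - 3 * v.2 * w.2, v.1 * w.2 + v.2 * w.1)

theorem heckePsi_rootMul (v w : ℤ × ℤ) :
    heckePsi (rootMul v w) = heckePsi v * heckePsi w := by
  have h := heckeChi_mul v.1 v.2 w.1 w.2
  have hs : (((v.1 * w.1 - 3 * v.2 * w.2 : ℤ) : ℂ) + ((v.1 * w.2 + v.2 * w.1 : ℤ) : ℂ) * rootNegThree)
      = (v.1 + v.2 * rootNegThree) * (w.1 + w.2 * rootNegThree) := by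
    push_cast
    linear_combination (- (v.2 : ℂ) * w.2) * rootNegThree_sq
  simp only [heckePsi, rootMul]
  rw [h, hs]; push_cast; ring

/-- The norm form `x ^ 2 + 3 * y ^ 2`. -/
def normThree (v : ℤ × ℤ) : ℤ := v.1 ^ 2 + 3 * v.2 ^ 2

theorem normThree_rootMul (v w : ℤ × ℤ) :
    normThree (rootMul v w) = normThree v * normThree w := by
  simp only [normThree, rootMul]; ring

/-- The representations of `N` by `x ^ 2 + 3 * y ^ 2`. -/
noncomputable def reps (N : ℕ) : Finset (ℤ × ℤ) :=
  ((Finset.Icc (-(N : ℤ)) N) ×ˢ (Finset.Icc (-(N : ℤ)) N)).filter fun v => normThree v = N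

theorem mem_reps {N : ℕ} {v : ℤ × ℤ} : v ∈ reps N ↔ normThree v = N := by
  rw [reps, Finset.mem_filter, and_iff_right_iff_imp, Finset.mem_product, Finset.mem_Icc,
    Finset.mem_Icc]
  intro h
  simp only [normThree] at h
  refine ⟨⟨?_, ?_⟩, ?_, ?_⟩ <;> nlinarith [sq_nonneg v.1, sq_nonneg v.2, Int.le_self_sq v.1,
    Int.le_self_sq (-v.1), Int.le_self_sq v.2, Int.le_self_sq (-v.2)]

/-- The sum of the Hecke character over the representations of `N`. -/
noncomputable def heckeSum (N : ℕ) : ℂ := ∑ v ∈ reps N, heckePsi v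

theorem rootMul_injective {v : ℤ × ℤ} (hv : normThree v ≠ 0) : Function.Injective (rootMul v) := by
  rintro ⟨a, b⟩ ⟨c, d⟩ h
  simp only [rootMul, Prod.mk.injEq, normThree] at h hv ⊢
  obtain ⟨h1, h2⟩ := h
  constructor
  · apply mul_left_cancel₀ hv
    linear_combination v.1 * h1 + 3 * v.2 * h2
  · apply mul_left_cancel₀ hv
    linear_combination v.1 * h2 - v.2 * h1

theorem sum_heckePsi_image (v : ℤ × ℤ) (hv : normThree v ≠ 0) (s : Finset (ℤ × ℤ)) :
    ∑ w ∈ s.image (rootMul v), heckePsi w = heckePsi v * ∑ w ∈ s, heckePsi w := by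
  rw [Finset.sum_image fun a _ b _ h => rootMul_injective hv h, Finset.mul_sum]
  exact Finset.sum_congr rfl fun w _ => heckePsi_rootMul v w

theorem not_isSquare_neg_three {p : ℕ} (hp : p.Prime) (h2 : p % 3 = 2) (hp2 : p ≠ 2) :
    ¬ IsSquare (-3 : ZMod p) := by
  have := Fact.mk hp
  rintro ⟨s, hs⟩
  have h20 : (2 : ZMod p) ≠ 0 := by
    intro h
    have : ((2 : ℕ) : ZMod p) = 0 := by exact_mod_cast h
    rw [ZMod.natCast_eq_zero_iff] at this
    exact hp2 ((Nat.prime_dvd_prime_iff_eq hp Nat.prime_two).1 this)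
  obtain ⟨t, ht⟩ : ∃ t : ZMod p, 2 * t = s - 1 := ⟨(s - 1) / 2, by field_simp⟩
  have hq : t ^ 2 + t + 1 = 0 := by
    have h4 : (2 * 2 : ZMod p) ≠ 0 := mul_ne_zero h20 h20
    apply mul_left_cancel₀ h4
    linear_combination (2 * t + s + 1) * ht - hs
  have h3 : t ^ 3 = 1 := by linear_combination (t - 1) * hq
  have ht0 : t ≠ 0 := by rintro rfl; simp at h3
  have hfer : t ^ (3 * (p / 3) + 2) = t := by
    rw [show 3 * (p / 3) + 2 = p by omega]
    exact ZMod.pow_card t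
  rw [pow_add, pow_mul, h3, one_pow, one_mul] at hfer
  have ht1 : t = 1 := by
    apply mul_left_cancel₀ ht0
    linear_combination hfer
  rw [ht1] at hq
  have : ((3 : ℕ) : ZMod p) = 0 := by push_cast; linear_combination hq
  rw [ZMod.natCast_eq_zero_iff, Nat.prime_dvd_prime_iff_eq hp Nat.prime_three] at this
  omega

theorem dvd_of_dvd_normThree_of_mod_three {p : ℕ} (hp : p.Prime) (h2 : p % 3 = 2) (hp2 : p ≠ 2)
    {v : ℤ × ℤ} (h : (p : ℤ) ∣ normThree v) : (p : ℤ) ∣ v.1 ∧ (p : ℤ) ∣ v.2 := by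
  have := Fact.mk hp
  by_contra hcon
  have hy : ¬ (p : ℤ) ∣ v.2 := by
    intro hy
    apply hcon
    refine ⟨?_, hy⟩
    have : (p : ℤ) ∣ v.1 ^ 2 := by
      have := dvd_sub h ((dvd_pow hy two_ne_zero).mul_left 3)
      simpa [normThree] using this
    exact (Nat.prime_iff_prime_int.mp hp).dvd_of_dvd_pow this
  apply not_isSquare_neg_three hp h2 hp2
  have h0 : ((normThree v : ℤ) : ZMod p) = 0 := (ZMod.intCast_zmod_eq_zero_iff_dvd _ _).2 h
  have hy0 : (v.2 : ZMod p) ≠ 0 := by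
    rwa [Ne, ZMod.intCast_zmod_eq_zero_iff_dvd]
  refine ⟨v.1 / v.2, ?_⟩
  simp only [normThree] at h0
  push_cast at h0
  field_simp
  linear_combination -h0

theorem exists_normThree_eq {p : ℕ} (hp : p.Prime) (h1 : p % 3 = 1) :
    ∃ v : ℤ × ℤ, normThree v = p := by
  have := Fact.mk hp
  have hp2 : p ≠ 2 := by rintro rfl; omega
  obtain ⟨s, hs⟩ : ∃ s : ZMod p, s ^ 2 = -3 := by
    have hdvd : 3 ∣ Nat.card (ZMod p)ˣ := by
      rw [Nat.card_eq_fintype_card, ZMod.card_units]; omega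
    obtain ⟨u, hu⟩ := exists_prime_orderOf_dvd_card' (G := (ZMod p)ˣ) 3 hdvd
    have hu3 : (u : ZMod p) ^ 3 = 1 := by
      rw [← Units.val_pow_eq_pow_val, ← hu, pow_orderOf_eq_one]; rfl
    have hu1 : (u : ZMod p) - 1 ≠ 0 := by
      intro h
      have : u = 1 := by
        ext; rw [Units.val_one]; linear_combination h
      rw [this, orderOf_one] at hu
      omega
    have hq : (u : ZMod p) ^ 2 + u + 1 = 0 := by
      apply mul_left_cancel₀ hu1
      linear_combination hu3
    exact ⟨2 * u + 1, by linear_combination 4 * hq⟩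
  -- pigeonhole
  set k := Nat.sqrt p with hk
  have hk1 : p < (k + 1) * (k + 1) := Nat.lt_succ_sqrt p
  have hk2 : k * k < p := by
    have := Nat.sqrt_le p
    rcases this.lt_or_eq with h | h
    · exact h
    · exfalso
      exact hp.prime.not_isSquare ⟨k, h.symm⟩
  let g : ℕ × ℕ → ZMod p := fun v => (v.1 : ZMod p) - s * v.2
  obtain ⟨v, hv, w, hw, hne, hg⟩ := Finset.exists_ne_map_eq_of_card_lt_of_maps_to
    (s := Finset.range (k + 1) ×ˢ Finset.range (k + 1)) (t := Finset.univ) (f := g)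
    (by simpa [ZMod.card] using hk1) (fun _ _ => Finset.mem_univ _)
  simp only [Finset.mem_product, Finset.mem_range, g] at hv hw hg
  obtain ⟨x, hx⟩ : ∃ x : ℤ, x = v.1 - w.1 := ⟨_, rfl⟩
  obtain ⟨y, hy⟩ : ∃ y : ℤ, y = v.2 - w.2 := ⟨_, rfl⟩
  have hx2 : x ^ 2 < p := by
    have h1 : |x| ≤ k := by rw [abs_le]; omega
    have : x ^ 2 ≤ (k : ℤ) ^ 2 := sq_le_sq' (abs_le.1 h1).1 (abs_le.1 h1).2
    have : (k : ℤ) * k < p := by exact_mod_cast hk2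
    nlinarith
  have hy2 : y ^ 2 < p := by
    have h1 : |y| ≤ k := by rw [abs_le]; omega
    have : y ^ 2 ≤ (k : ℤ) ^ 2 := sq_le_sq' (abs_le.1 h1).1 (abs_le.1 h1).2
    have : (k : ℤ) * k < p := by exact_mod_cast hk2
    nlinarith
  have hpos : 0 < x ^ 2 + 3 * y ^ 2 := by
    by_contra hcon
    have hx0 : x = 0 := by nlinarith [sq_nonneg x, sq_nonneg y]
    have hy0 : y = 0 := by nlinarith [sq_nonneg x, sq_nonneg y]
    exact hne (Prod.ext (by omega) (by omega))
  have hd : (p : ℤ) ∣ x ^ 2 + 3 * y ^ 2 := by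
    rw [← ZMod.intCast_zmod_eq_zero_iff_dvd]
    have hxy : (x : ZMod p) = s * y := by
      rw [hx, hy]; push_cast; linear_combination hg
    push_cast
    rw [hxy]; linear_combination (y : ZMod p) ^ 2 * hs
  obtain ⟨c, hc⟩ := hd
  have hp0 : (0 : ℤ) < p := by exact_mod_cast hp.pos
  have hc1 : 0 < c := by
    by_contra h; nlinarith
  have hc4 : c < 4 := by
    by_contra h; nlinarith
  have hpo : p % 2 = 1 := hp.eq_two_or_odd.resolve_left hp2
  interval_cases c
  · exact ⟨(x, y), by simp only [normThree]; linarith⟩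
  · exfalso
    have h4 : (x ^ 2 + 3 * y ^ 2) % 4 = 2 := by rw [hc]; omega
    rcases Int.even_or_odd' x with ⟨i, rfl | rfl⟩ <;> rcases Int.even_or_odd' y with ⟨j, rfl | rfl⟩ <;>
      ring_nf at h4 <;> omega
  · obtain ⟨z, rfl⟩ : (3 : ℤ) ∣ x :=
      Int.prime_three.dvd_of_dvd_pow (n := 2) ⟨p - y ^ 2, by linarith⟩
    exact ⟨(y, z), by simp only [normThree]; nlinarith⟩

theorem eq_of_sq_add_three_sq {p : ℕ} (hp : p.Prime) {a b c d : ℤ} (ha : 0 < a) (hb : 0 < b)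
    (hc : 0 < c) (hd : 0 < d) (hab : a ^ 2 + 3 * b ^ 2 = p) (hcd : c ^ 2 + 3 * d ^ 2 = p) :
    a = c ∧ b = d := by
  have hpp := Nat.prime_iff_prime_int.mp hp
  have hp0 : (0 : ℤ) < p := by exact_mod_cast hp.pos
  have hdvd : (p : ℤ) ∣ (a * d - b * c) * (a * d + b * c) :=
    ⟨d ^ 2 - b ^ 2, by linear_combination d ^ 2 * hab - b ^ 2 * hcd⟩
  have e1 : (a * c + 3 * b * d) ^ 2 + 3 * (a * d - b * c) ^ 2 = p * p := by
    linear_combination (c ^ 2 + 3 * d ^ 2) * hab + p * hcd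
  have e2 : (a * c - 3 * b * d) ^ 2 + 3 * (a * d + b * c) ^ 2 = p * p := by
    linear_combination (c ^ 2 + 3 * d ^ 2) * hab + p * hcd
  have hbd : (d - b) * (d + b) = 0 := by
    rcases hpp.dvd_or_dvd hdvd with ⟨t, ht⟩ | ⟨t, ht⟩
    · have ht0 : t = 0 := by
        by_contra h
        have : 1 ≤ t ^ 2 := by
          have := sq_pos_of_ne_zero h; omega
        rw [ht] at e1
        nlinarith [sq_nonneg (a * c + 3 * b * d)]
      rw [ht0, mul_zero] at ht
      apply mul_left_cancel₀ hp0.ne'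
      linear_combination (a * d + b * c) * ht - d ^ 2 * hab + b ^ 2 * hcd
    · exfalso
      have : 0 < a * d + b * c := by positivity
      have h1 : (p : ℤ) ≤ a * d + b * c := Int.le_of_dvd this ⟨t, ht⟩
      nlinarith [sq_nonneg (a * c - 3 * b * d)]
  have hbd' : b = d := by
    rcases mul_eq_zero.1 hbd with h | h <;> omega
  subst hbd'
  refine ⟨?_, rfl⟩
  have : (a - c) * (a + c) = 0 := by linear_combination hab - hcd
  rcases mul_eq_zero.1 this with h | h <;> omega

/-- `p ∣ N(v)` forces divisibility of `v` by `π` or its conjugate. -/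
theorem exists_eq_rootMul {p : ℕ} (hp : p.Prime) {a b : ℤ} (hab : a ^ 2 + 3 * b ^ 2 = p)
    {M : ℕ} {v : ℤ × ℤ} (h : normThree v = p * M) :
    ∃ w : ℤ × ℤ, normThree w = M ∧ (v = rootMul (a, b) w ∨ v = rootMul (a, -b) w) := by
  obtain ⟨x, y⟩ := v
  simp only [normThree] at h
  have hpp := Nat.prime_iff_prime_int.mp hp
  have key : ∀ b : ℤ, a ^ 2 + 3 * b ^ 2 = p → (p : ℤ) ∣ a * y - b * x →
      ∃ w : ℤ × ℤ, normThree w = M ∧ (x, y) = rootMul (a, b) w := by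
    rintro b hab ⟨d, hd⟩
    have h1 : (p : ℤ) ∣ a * x + 3 * b * y := by
      apply hpp.dvd_of_dvd_pow (n := 2)
      refine ⟨p * M - 3 * p * d ^ 2, ?_⟩
      have : (a * x + 3 * b * y) ^ 2 + 3 * (a * y - b * x) ^ 2 = p * (p * M) := by
        rw [← h, ← hab]; ring
      rw [hd] at this
      linear_combination this
    obtain ⟨c, hc⟩ := h1
    have hp0 : (p : ℤ) ≠ 0 := hpp.ne_zero
    have hx : x = a * c - 3 * b * d := by
      apply mul_left_cancel₀ hp0
      linear_combination (-x) * hab + a * hc - 3 * b * hd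
    have hy : y = a * d + b * c := by
      apply mul_left_cancel₀ hp0
      linear_combination (-y) * hab + a * hd + b * hc
    refine ⟨(c, d), ?_, ?_⟩
    · simp only [normThree]
      apply mul_left_cancel₀ hp0
      rw [← h, hx, hy, ← hab]; ring
    · simp only [rootMul, hx, hy]
  have : (p : ℤ) ∣ (a * y - b * x) * (a * y - (-b) * x) := by
    refine ⟨y ^ 2 - b ^ 2 * M, ?_⟩
    linear_combination (y ^ 2) * hab - b ^ 2 * h
  rcases hpp.dvd_or_dvd this with h1 | h1
  · obtain ⟨w, hw, e⟩ := key b hab h1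
    exact ⟨w, hw, Or.inl e⟩
  · obtain ⟨w, hw, e⟩ := key (-b) (by linear_combination hab) h1
    exact ⟨w, hw, Or.inr e⟩

theorem heckeSum_of_dvd_of_mod_three {p : ℕ} (hp : p.Prime) (h2 : p % 3 = 2) (hp2 : p ≠ 2) (M : ℕ) :
    heckeSum (p * M) = if p ∣ M then heckePsi (p, 0) * heckeSum (M / p) else 0 := by
  have hpp := Nat.prime_iff_prime_int.mp hp
  have hp0 : (p : ℤ) ≠ 0 := hpp.ne_zero
  have hkey : ∀ v ∈ reps (p * M), ∃ w : ℤ × ℤ, v = rootMul (p, 0) w ∧ (p : ℤ) * normThree w = M := by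
    rintro ⟨x, y⟩ hv
    rw [mem_reps] at hv
    obtain ⟨⟨c, hc⟩, d, hd⟩ := dvd_of_dvd_normThree_of_mod_three hp h2 hp2 (v := (x, y))
      ⟨M, by rw [hv]; push_cast; rfl⟩
    refine ⟨(c, d), by simp only [rootMul]; ext <;> simp_all, ?_⟩
    apply mul_left_cancel₀ hp0
    simp only [normThree] at hv hc hd ⊢
    rw [hc, hd] at hv
    push_cast at hv
    linear_combination hv
  have hn : normThree ((p : ℤ), 0) = p * p := by simp only [normThree]; ring
  split_ifs with h
  · obtain ⟨m, rfl⟩ := h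
    rw [Nat.mul_div_cancel_left _ hp.pos]
    unfold heckeSum
    rw [← sum_heckePsi_image _ (by rw [hn]; positivity)]
    congr 1
    ext v
    simp only [Finset.mem_image]
    constructor
    · intro hv
      obtain ⟨w, rfl, hw⟩ := hkey v hv
      refine ⟨w, ?_, rfl⟩
      rw [mem_reps]
      apply mul_left_cancel₀ hp0
      rw [hw]; push_cast; rfl
    · rintro ⟨w, hw, rfl⟩
      rw [mem_reps] at hw ⊢
      rw [normThree_rootMul, hn, hw]; push_cast; ring
  · unfold heckeSum
    rw [Finset.sum_eq_zero]
    intro v hv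
    obtain ⟨w, -, hw⟩ := hkey v hv
    exact absurd (Int.natCast_dvd_natCast.1 ⟨_, hw.symm⟩) h

theorem heckeSum_mul_of_normThree_eq {p : ℕ} (hp : p.Prime) (h3 : p ≠ 3) (hp2 : p ≠ 2) {a b : ℤ}
    (hab : a ^ 2 + 3 * b ^ 2 = p) (M : ℕ) :
    heckeSum (p * M) = (heckePsi (a, b) + heckePsi (a, -b)) * heckeSum M -
      if p ∣ M then heckePsi (p, 0) * heckeSum (M / p) else 0 := by
  have hpp := Nat.prime_iff_prime_int.mp hp
  have hp0 : (p : ℤ) ≠ 0 := hpp.ne_zero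
  have hn1 : normThree (a, b) = p := hab
  have hn2 : normThree (a, -b) = p := by rw [← hab]; simp [normThree]
  have hn : normThree ((p : ℤ), 0) = p * p := by simp only [normThree]; ring
  have hpa : ¬ (p : ℤ) ∣ a := by
    intro h
    have hb : (p : ℤ) ∣ 3 * b ^ 2 := by
      have := dvd_sub (dvd_refl (p : ℤ)) (dvd_pow h two_ne_zero)
      rwa [show (p : ℤ) - a ^ 2 = 3 * b ^ 2 by rw [← hab]; ring] at this
    rcases hpp.dvd_or_dvd hb with hb | hb
    · have := (Int.natCast_dvd_natCast (n := 3)).1 (by exact_mod_cast hb)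
      exact h3 ((Nat.prime_dvd_prime_iff_eq hp Nat.prime_three).1 this)
    · have hb := hpp.dvd_of_dvd_pow hb
      have h2 : (p : ℤ) * p ∣ p := by
        nth_rewrite 3 [← hab]
        rw [← sq]
        exact dvd_add (pow_dvd_pow_of_dvd h 2) ((pow_dvd_pow_of_dvd hb 2).mul_left 3)
      have h4 := (Int.natCast_dvd_natCast (m := p * p) (n := p)).1 (by push_cast; exact h2)
      have := Nat.le_of_dvd hp.pos h4
      nlinarith [hp.two_le]
  have hpb : ¬ (p : ℤ) ∣ b := by
    intro h
    apply hpa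
    have ha : (p : ℤ) ∣ a ^ 2 := by
      have := dvd_sub (dvd_refl (p : ℤ)) ((dvd_pow h two_ne_zero).mul_left 3)
      rwa [show (p : ℤ) - 3 * b ^ 2 = a ^ 2 by rw [← hab]; ring] at this
    exact hpp.dvd_of_dvd_pow ha
  have hunion : reps (p * M) = (reps M).image (rootMul (a, b)) ∪ (reps M).image (rootMul (a, -b)) := by
    ext v
    simp only [Finset.mem_union, Finset.mem_image, mem_reps]
    constructor
    · intro hv
      obtain ⟨w, hw, e | e⟩ := exists_eq_rootMul hp hab (v := v) (M := M) (by rw [hv]; push_cast; rfl)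
      · exact Or.inl ⟨w, hw, e.symm⟩
      · exact Or.inr ⟨w, hw, e.symm⟩
    · rintro (⟨w, hw, rfl⟩ | ⟨w, hw, rfl⟩)
      · rw [normThree_rootMul, hw, hn1]; push_cast; rfl
      · rw [normThree_rootMul, hw, hn2]; push_cast; rfl
  have hinter : ∀ v ∈ (reps M).image (rootMul (a, b)) ∩ (reps M).image (rootMul (a, -b)),
      ∃ w : ℤ × ℤ, v = rootMul (p, 0) w ∧ (p : ℤ) * normThree w = M := by
    intro v hv
    simp only [Finset.mem_inter, Finset.mem_image, mem_reps] at hv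
    obtain ⟨⟨⟨x, y⟩, hw, rfl⟩, ⟨z, t⟩, -, he⟩ := hv
    simp only [rootMul, Prod.mk.injEq] at he
    obtain ⟨he1, he2⟩ := he
    have hp2' : ¬ (p : ℤ) ∣ 2 := by
      intro h
      have := (Int.natCast_dvd_natCast (n := 2)).1 (by exact_mod_cast h)
      exact hp2 ((Nat.prime_dvd_prime_iff_eq hp Nat.prime_two).1 this)
    have hY : (p : ℤ) ∣ a * y + b * x := by
      have : (p : ℤ) ∣ 2 * (a * (a * y + b * x)) := by
        refine ⟨y + t, ?_⟩
        linear_combination (y + t) * hab - a * he2 - b * he1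
      exact ((hpp.dvd_or_dvd ((hpp.dvd_or_dvd this).resolve_left hp2')).resolve_left hpa)
    have hX : (p : ℤ) ∣ a * x - 3 * b * y := by
      have : (p : ℤ) ∣ b * (a * x - 3 * b * y) := by
        have h1 := dvd_sub (hY.mul_left a) (dvd_mul_right (p : ℤ) y)
        have : b * (a * x - 3 * b * y) = a * (a * y + b * x) - p * y := by
          linear_combination (-y) * hab
        rwa [this]
      exact (hpp.dvd_or_dvd this).resolve_left hpb
    obtain ⟨c, hc⟩ := hX
    obtain ⟨d, hd⟩ := hY
    refine ⟨(c, d), by simp only [rootMul]; ext <;> simp_all, ?_⟩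
    simp only [normThree] at hw ⊢
    apply mul_left_cancel₀ hp0
    rw [← hw]
    have e : (a ^ 2 + 3 * b ^ 2) * (x ^ 2 + 3 * y ^ 2) =
      (a * x - 3 * b * y) ^ 2 + 3 * (a * y + b * x) ^ 2 := by ring
    rw [hab, hc, hd] at e
    linear_combination -e
  have hsum := Finset.sum_union_inter (s₁ := (reps M).image (rootMul (a, b)))
    (s₂ := (reps M).image (rootMul (a, -b))) (f := heckePsi)
  rw [← hunion, sum_heckePsi_image _ (by rw [hn1]; exact hp0),
    sum_heckePsi_image _ (by rw [hn2]; exact hp0)] at hsum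
  have hinter : ∑ v ∈ (reps M).image (rootMul (a, b)) ∩ (reps M).image (rootMul (a, -b)), heckePsi v =
      if p ∣ M then heckePsi (p, 0) * heckeSum (M / p) else 0 := by
    split_ifs with h
    · obtain ⟨m, rfl⟩ := h
      rw [Nat.mul_div_cancel_left _ hp.pos]
      unfold heckeSum
      rw [← sum_heckePsi_image _ (by rw [hn]; positivity)]
      congr 1
      ext v
      constructor
      · intro hv
        obtain ⟨w, rfl, hw⟩ := hinter v hv
        refine Finset.mem_image.2 ⟨w, ?_, rfl⟩
        rw [mem_reps]
        apply mul_left_cancel₀ hp0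
        rw [hw]; push_cast; rfl
      · intro hv
        obtain ⟨⟨x, y⟩, hw, rfl⟩ := Finset.mem_image.1 hv
        rw [mem_reps] at hw
        simp only [Finset.mem_inter, Finset.mem_image, mem_reps]
        refine ⟨⟨rootMul (a, -b) (x, y), ?_, ?_⟩, ⟨rootMul (a, b) (x, y), ?_, ?_⟩⟩
        · rw [normThree_rootMul, hw, hn2]; push_cast; rfl
        · simp only [rootMul, ← hab]; ext <;> ring
        · rw [normThree_rootMul, hw, hn1]; push_cast; rfl
        · simp only [rootMul, ← hab]; ext <;> ring
    · rw [Finset.sum_eq_zero]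
      intro v hv
      obtain ⟨w, -, hw⟩ := hinter v hv
      exact absurd (Int.natCast_dvd_natCast.1 ⟨_, hw.symm⟩) h
  rw [hinter] at hsum
  unfold heckeSum at hsum ⊢
  linear_combination hsum

theorem heckeSum_one : heckeSum 1 = 2 := by
  have h : reps 1 = {(1, 0), (-1, 0)} := by
    ext ⟨x, y⟩
    rw [mem_reps]
    simp only [normThree, Finset.mem_insert, Finset.mem_singleton, Prod.mk.injEq]
    constructor
    · intro h
      have hy : y = 0 := by
        by_contra h0
        have := sq_pos_of_ne_zero h0
        push_cast at h
        nlinarith [sq_nonneg x]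
      subst hy
      have : (x - 1) * (x + 1) = 0 := by push_cast at h; linear_combination h
      rcases mul_eq_zero.1 this with h | h
      · left; omega
      · right; omega
    · rintro (⟨rfl, rfl⟩ | ⟨rfl, rfl⟩) <;> norm_num
  have h1 : heckeChi 1 0 = 1 := by decide
  have h2 : heckeChi (-1) 0 = 1 := by decide
  rw [heckeSum, h, Finset.sum_pair (by decide)]
  simp only [heckePsi, h1, h2]
  norm_num

theorem heckeChi_mod (x y : ℤ) : heckeChi (x % 12) (y % 12) = heckeChi x y := by
  have h3 : ((x % 12 : ℤ) : ZMod 3) = x := by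
    rw [ZMod.intCast_eq_intCast_iff]; exact Int.emod_emod_of_dvd x (by norm_num)
  have h4 (z : ℤ) : ((z % 12 : ℤ) : ZMod 4) = z := by
    rw [ZMod.intCast_eq_intCast_iff]; exact Int.emod_emod_of_dvd z (by norm_num)
  rw [heckeChi, heckeChi, h3, h4, h4]

theorem heckePsi_natCast_zero (p : ℕ) (e : ℤ) (h : heckeChi ((p % 12 : ℕ) : ℤ) 0 = e) :
    heckePsi (p, 0) = e * (p : ℂ) ^ 6 := by
  have := heckeChi_mod p 0
  rw [heckePsi, ← this, ← h]
  simp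

theorem heckePsi_conj_odd (a b : ℤ) (h : heckeChi a (-b) = -heckeChi a b) :
    heckePsi (a, b) + heckePsi (a, -b) =
      12 * heckeChi a b * a * b * ((a : ℂ) ^ 2 - b ^ 2) * ((a : ℂ) ^ 2 - 9 * b ^ 2) *
        rootNegThree := by
  simp only [heckePsi, h]
  push_cast
  linear_combination (12 * heckeChi a b * a * b * rootNegThree *
    (b ^ 4 * (rootNegThree ^ 2 - 3) + (10 / 3 : ℂ) * a ^ 2 * b ^ 2)) * rootNegThree_sq

theorem heckePsi_conj_even (a b : ℤ) (h : heckeChi a (-b) = heckeChi a b) :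
    heckePsi (a, b) + heckePsi (a, -b) =
      -2 * heckeChi a b * ((a : ℂ) ^ 2 - 3 * b ^ 2) *
        (6 * a * b + (a : ℂ) ^ 2 - 3 * b ^ 2) * (6 * a * b + 3 * b ^ 2 - (a : ℂ) ^ 2) := by
  simp only [heckePsi, h]
  push_cast
  linear_combination (heckeChi a b * (2 * b ^ 6 * (rootNegThree ^ 4 - 3 * rootNegThree ^ 2 + 9)
    + 30 * a ^ 2 * b ^ 4 * (rootNegThree ^ 2 - 3) + 30 * a ^ 4 * b ^ 2)) * rootNegThree_sq

theorem sign_of_seven_mod_twelve : ∀ r t : Fin 12, ((r : ℕ) ^ 2 + 3 * (t : ℕ) ^ 2) % 12 = 7 →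
    (if ((r : ℕ) ^ 2 + 3 * (t : ℕ) ^ 2) % 24 = 7 then (1 : ℤ) else -1) *
      (if ((r : ℕ) % 6 = 2 ∧ (t : ℕ) % 4 ≠ 1) ∨ ((r : ℕ) % 6 ≠ 2 ∧ (t : ℕ) % 4 = 1)
        then -1 else 1) = -heckeChi (r : ℕ) (t : ℕ) ∧
    heckeChi (r : ℕ) (-(t : ℕ)) = -heckeChi (r : ℕ) (t : ℕ) := by decide

theorem sign_of_one_mod_twelve : ∀ r t : Fin 12, ((r : ℕ) ^ 2 + 3 * (t : ℕ) ^ 2) % 12 = 1 →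
    (if (r : ℕ) = 5 ∨ (r : ℕ) = 7 then (if (t : ℕ) % 4 < 2 then (1 : ℤ) else -1)
      else if (t : ℕ) % 4 < 2 then -1 else 1) = -heckeChi (r : ℕ) (t : ℕ) ∧
    heckeChi (r : ℕ) (-(t : ℕ)) = heckeChi (r : ℕ) (t : ℕ) := by decide

theorem heckeChi_natCast_mod (x y : ℕ) :
    heckeChi ((x % 12 : ℕ) : ℤ) ((y % 12 : ℕ) : ℤ) = heckeChi x y ∧
    heckeChi ((x % 12 : ℕ) : ℤ) (-((y % 12 : ℕ) : ℤ)) = heckeChi x (-y) := by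
  constructor
  · rw [← heckeChi_mod x y]; push_cast; rfl
  · rw [← heckeChi_mod x (-y), ← heckeChi_mod _ (-((y % 12 : ℕ) : ℤ))]
    congr 1 <;> omega

theorem sq_add_three_sq_mod (x y k : ℕ) (hk : k ∣ 24) :
    ((x % 12) ^ 2 + 3 * (y % 12) ^ 2) % k = (x ^ 2 + 3 * y ^ 2) % k := by
  have key (z : ℕ) : ((z % 12) ^ 2) ≡ z ^ 2 [MOD 24] := by
    conv_rhs => rw [← Nat.mod_add_div z 12]
    unfold Nat.ModEq
    have : (z % 12 + 12 * (z / 12)) ^ 2 =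
      (z % 12) ^ 2 + 24 * ((z % 12) * (z / 12) + 6 * (z / 12) ^ 2) := by ring
    rw [this, Nat.add_mul_mod_self_left]
  exact (((key x).add ((key y).mul_left 3)).of_dvd hk)

theorem heckePsi_conj_of_seven {p x y : ℕ} (hp7 : p % 12 = 7) (h : p = x ^ 2 + 3 * y ^ 2) :
    heckePsi (x, y) + heckePsi (x, -y) = 12 * (-1) ^ ((p - 7) / 12) *
        (if (x % 6 = 2 ∧ y % 4 ≠ 1) ∨ (x % 6 ≠ 2 ∧ y % 4 = 1) then (-1 : ℂ) else 1) *
        x * y * ((x : ℂ) ^ 2 - (y : ℂ) ^ 2) * (9 * (y : ℂ) ^ 2 - (x : ℂ) ^ 2) *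
        Real.sqrt 3 * Complex.I := by
  have hs := sign_of_seven_mod_twelve ⟨x % 12, Nat.mod_lt _ (by norm_num)⟩
    ⟨y % 12, Nat.mod_lt _ (by norm_num)⟩
    (by rw [sq_add_three_sq_mod x y 12 (by norm_num), ← h, hp7])
  simp only [sq_add_three_sq_mod x y 24 dvd_rfl, ← h, (heckeChi_natCast_mod x y).1,
    (heckeChi_natCast_mod x y).2, Nat.mod_mod_of_dvd _ (show 6 ∣ 12 by norm_num),
    Nat.mod_mod_of_dvd _ (show 4 ∣ 12 by norm_num)] at hs
  obtain ⟨hs1, hs2⟩ := hs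
  have hpow : (-1 : ℂ) ^ ((p - 7) / 12) = ((if p % 24 = 7 then (1 : ℤ) else -1 : ℤ) : ℂ) := by
    split_ifs with h24
    · rw [Even.neg_one_pow (by rw [Nat.even_iff]; omega)]; simp
    · rw [Odd.neg_one_pow (by rw [Nat.odd_iff]; omega)]; simp
  rw [heckePsi_conj_odd _ _ hs2]
  have hs1' := congrArg (fun z : ℤ => (z : ℂ)) hs1
  push_cast at hs1' hpow
  rw [hpow, rootNegThree]
  push_cast
  linear_combination (-12 * (x : ℂ) * y * ((x : ℂ) ^ 2 - (y : ℂ) ^ 2) *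
    (9 * (y : ℂ) ^ 2 - (x : ℂ) ^ 2) * Real.sqrt 3 * Complex.I) * hs1'

theorem heckePsi_conj_of_one {p x y : ℕ} (hp1 : p % 12 = 1) (h : p = x ^ 2 + 3 * y ^ 2) :
    heckePsi (x, y) + heckePsi (x, -y) = 2 *
        (if x % 12 = 5 ∨ x % 12 = 7 then ((-1 : ℂ)) ^ (y / 2) else (-1 : ℂ) ^ (y / 2 + 1)) *
        ((x : ℂ) ^ 2 - 3 * (y : ℂ) ^ 2) *
        (6 * (x : ℂ) * y + (x : ℂ) ^ 2 - 3 * (y : ℂ) ^ 2) *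
        (6 * (x : ℂ) * y + 3 * (y : ℂ) ^ 2 - (x : ℂ) ^ 2) := by
  have hs := sign_of_one_mod_twelve ⟨x % 12, Nat.mod_lt _ (by norm_num)⟩
    ⟨y % 12, Nat.mod_lt _ (by norm_num)⟩
    (by rw [sq_add_three_sq_mod x y 12 (by norm_num), ← h, hp1])
  simp only [(heckeChi_natCast_mod x y).1, (heckeChi_natCast_mod x y).2,
    Nat.mod_mod_of_dvd _ (show 4 ∣ 12 by norm_num)] at hs
  obtain ⟨hs1, hs2⟩ := hs
  have hpow : (-1 : ℂ) ^ (y / 2) = if y % 4 < 2 then 1 else -1 := by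
    split_ifs with h4
    · rw [Even.neg_one_pow (by rw [Nat.even_iff]; omega)]
    · rw [Odd.neg_one_pow (by rw [Nat.odd_iff]; omega)]
  have hsgn : (if x % 12 = 5 ∨ x % 12 = 7 then ((-1 : ℂ)) ^ (y / 2) else (-1 : ℂ) ^ (y / 2 + 1)) =
      -heckeChi x y := by
    rw [pow_succ, hpow]
    have hs1' := congrArg (fun z : ℤ => (z : ℂ)) hs1
    push_cast at hs1'
    rw [← hs1']
    split_ifs <;> norm_num
  rw [heckePsi_conj_even _ _ hs2, hsgn]
  push_cast
  ring

theorem apply_prime_mul {f : ℕ → ℂ}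
    (hfmul : ∀ m n : ℕ, Nat.Coprime m n → f (m * n) = f m * f n) {p : ℕ} (hp : p.Prime) {c e : ℂ}
    (hc : f p = c) (hrec : ∀ r, f (p ^ (r + 2)) = c * f (p ^ (r + 1)) - e * f (p ^ r))
    {M : ℕ} (hM : M ≠ 0) :
    f (p * M) = c * f M - if p ∣ M then e * f (M / p) else 0 := by
  obtain ⟨r, m, hm, rfl⟩ := Nat.exists_eq_pow_mul_and_not_dvd hM p hp.ne_one
  have hcop (k : ℕ) : f (p ^ k * m) = f (p ^ k) * f m :=
    hfmul _ _ (((Nat.Prime.coprime_iff_not_dvd hp).2 hm).pow_left k)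
  rcases r with _ | r
  · rw [pow_zero, one_mul, if_neg hm, sub_zero, ← hc]
    simpa using hcop 1
  · rw [if_pos ((dvd_pow_self p r.succ_ne_zero).mul_right m)]
    have h1 : p * (p ^ (r + 1) * m) = p ^ (r + 2) * m := by ring
    have h2 : p ^ (r + 1) * m / p = p ^ r * m := by
      rw [pow_succ', mul_assoc, Nat.mul_div_cancel_left _ hp.pos]
    rw [h1, h2, hcop, hcop, hcop, hrec]
    ring

theorem heckeSum_eq_two_mul {f : ℕ → ℂ} (hf1 : f 1 = 1)
    (hfmul : ∀ m n : ℕ, Nat.Coprime m n → f (m * n) = f m * f n)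
    (hinert : ∀ p : ℕ, p.Prime → p % 3 = 2 → p ≠ 2 →
      f p = 0 ∧ ∀ r, f (p ^ (r + 2)) = heckePsi (p, 0) * f (p ^ r))
    (hsplit : ∀ p : ℕ, p.Prime → p % 3 = 1 → ∃ a b : ℤ, a ^ 2 + 3 * b ^ 2 = p ∧
      f p = heckePsi (a, b) + heckePsi (a, -b) ∧
      ∀ r, f (p ^ (r + 2)) = f p * f (p ^ (r + 1)) - heckePsi (p, 0) * f (p ^ r))
    (N : ℕ) (hN2 : N % 2 = 1) (hN3 : N % 3 ≠ 0) : heckeSum N = 2 * f N := by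
  induction N using Nat.strong_induction_on with
  | _ N ih =>
  rcases eq_or_ne N 1 with rfl | hN1
  · rw [heckeSum_one, hf1, mul_one]
  obtain ⟨p, hp, M, rfl⟩ := Nat.exists_prime_and_dvd hN1
  have hM : M ≠ 0 := by rintro rfl; simp at hN2
  have hp2 : p ≠ 2 := by rintro rfl; omega
  have hp3 : p ≠ 3 := by rintro rfl; omega
  have hodd : ∀ {d : ℕ}, d ∣ p * M → d % 2 = 1 ∧ d % 3 ≠ 0 := by
    rintro d hd
    constructor
    · by_contra h
      have : 2 ∣ p * M := (Nat.dvd_of_mod_eq_zero (by omega)).trans hd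
      omega
    · intro h
      have : 3 ∣ p * M := (Nat.dvd_of_mod_eq_zero h).trans hd
      omega
  have hlt : M < p * M := lt_mul_of_one_lt_left (Nat.pos_of_ne_zero hM) hp.one_lt
  have ihM : heckeSum M = 2 * f M :=
    ih M hlt (hodd (dvd_mul_left M p)).1 (hodd (dvd_mul_left M p)).2
  have ihMp (h : p ∣ M) : heckeSum (M / p) = 2 * f (M / p) := by
    have hd : M / p ∣ p * M := (Nat.div_dvd_of_dvd h).trans (dvd_mul_left M p)
    exact ih _ ((Nat.div_le_self M p).trans_lt hlt) (hodd hd).1 (hodd hd).2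
  have hp0 : p % 3 ≠ 0 := (hodd (dvd_mul_right p M)).2
  rcases (by omega : p % 3 = 1 ∨ p % 3 = 2) with h1 | h2
  · obtain ⟨a, b, hab, hfp, hrec⟩ := hsplit p hp h1
    rw [heckeSum_mul_of_normThree_eq hp hp3 hp2 hab, apply_prime_mul hfmul hp rfl hrec hM, ihM, hfp]
    split_ifs with h
    · rw [ihMp h]; ring
    · ring
  · obtain ⟨hfp, hrec⟩ := hinert p hp h2 hp2
    rw [heckeSum_of_dvd_of_mod_three hp h2 hp2, apply_prime_mul hfmul hp hfp
      (e := -heckePsi (p, 0)) (fun r => by rw [hrec]; ring) hM]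
    split_ifs with h
    · rw [ihMp h]; ring
    · ring

theorem exists_pos_eq_sq_add_three_sq {p : ℕ} (hp : p.Prime) (h1 : p % 3 = 1) :
    ∃ x y : ℕ, 0 < x ∧ 0 < y ∧ p = x ^ 2 + 3 * y ^ 2 := by
  obtain ⟨⟨a, b⟩, hab⟩ := exists_normThree_eq hp h1
  have h : p = a.natAbs ^ 2 + 3 * b.natAbs ^ 2 := by
    zify; simpa [normThree, sq_abs] using hab.symm
  refine ⟨_, _, Nat.pos_of_ne_zero fun h0 => ?_, Nat.pos_of_ne_zero fun h0 => ?_, h⟩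
  · rw [h0] at h; omega
  · rw [h0] at h
    have : IsSquare p := ⟨a.natAbs, by rw [h]; ring⟩
    exact (Nat.prime_iff.mp hp).irreducible.not_isSquare this

theorem existsUnique_eq_sq_add_three_sq {p : ℕ} (hp : p.Prime) (h1 : p % 3 = 1) :
    ∃! xy : ℕ × ℕ, 0 < xy.1 ∧ 0 < xy.2 ∧ p = xy.1 ^ 2 + 3 * xy.2 ^ 2 := by
  obtain ⟨x, y, hx, hy, h⟩ := exists_pos_eq_sq_add_three_sq hp h1
  refine ⟨(x, y), ⟨hx, hy, h⟩, ?_⟩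
  rintro ⟨z, w⟩ ⟨hz, hw, h'⟩
  obtain ⟨e1, e2⟩ := eq_of_sq_add_three_sq hp (a := z) (b := w) (c := x) (d := y)
    (by exact_mod_cast hz) (by exact_mod_cast hw) (by exact_mod_cast hx) (by exact_mod_cast hy)
    (by exact_mod_cast h'.symm) (by exact_mod_cast h.symm)
  simp only [Prod.mk.injEq]
  exact ⟨by exact_mod_cast e1, by exact_mod_cast e2⟩

theorem heckeSum_eq_two_mul_of_values {f : ℕ → ℂ} (hf1 : f 1 = 1)
    (hfmul : ∀ m n : ℕ, Nat.Coprime m n → f (m * n) = f m * f n)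
    (hfa : ∀ p r : ℕ, p.Prime → 1 ≤ r → p % 12 = 5 → Even r →
      f (p ^ r) = (-1) ^ (r / 2) * (p : ℂ) ^ (3 * r))
    (hfb : ∀ p r : ℕ, p.Prime → 1 ≤ r → p % 12 = 11 → Even r →
      f (p ^ r) = (p : ℂ) ^ (3 * r))
    (hfc : ∀ p r : ℕ, p.Prime → 1 ≤ r → (p % 12 = 5 ∨ p % 12 = 11) → Odd r →
      f (p ^ r) = 0)
    (hfe : ∀ p x y : ℕ, p.Prime → p % 12 = 7 → 0 < x → 0 < y →
      p = x ^ 2 + 3 * y ^ 2 →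
      f p = 12 * (-1) ^ ((p - 7) / 12) *
        (if (x % 6 = 2 ∧ y % 4 ≠ 1) ∨ (x % 6 ≠ 2 ∧ y % 4 = 1) then (-1 : ℂ) else 1) *
        x * y * ((x : ℂ) ^ 2 - (y : ℂ) ^ 2) * (9 * (y : ℂ) ^ 2 - (x : ℂ) ^ 2) *
        Real.sqrt 3 * Complex.I)
    (hff : ∀ p r : ℕ, p.Prime → p % 12 = 7 → 2 ≤ r →
      f (p ^ r) = f p * f (p ^ (r - 1)) + (p : ℂ) ^ 6 * f (p ^ (r - 2)))
    (hfg : ∀ p x y : ℕ, p.Prime → p % 12 = 1 → 0 < x → 0 < y →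
      p = x ^ 2 + 3 * y ^ 2 →
      f p = 2 *
        (if x % 12 = 5 ∨ x % 12 = 7 then ((-1 : ℂ)) ^ (y / 2) else (-1 : ℂ) ^ (y / 2 + 1)) *
        ((x : ℂ) ^ 2 - 3 * (y : ℂ) ^ 2) *
        (6 * (x : ℂ) * y + (x : ℂ) ^ 2 - 3 * (y : ℂ) ^ 2) *
        (6 * (x : ℂ) * y + 3 * (y : ℂ) ^ 2 - (x : ℂ) ^ 2))
    (hfh : ∀ p r : ℕ, p.Prime → p % 12 = 1 → 2 ≤ r →
      f (p ^ r) = f p * f (p ^ (r - 1)) - (p : ℂ) ^ 6 * f (p ^ (r - 2)))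
    (N : ℕ) (hN2 : N % 2 = 1) (hN3 : N % 3 ≠ 0) : heckeSum N = 2 * f N := by
  refine heckeSum_eq_two_mul hf1 hfmul ?_ ?_ N hN2 hN3
  · intro p hp h2 hp2
    have hp12 : p % 12 = 5 ∨ p % 12 = 11 := by
      have := hp.eq_two_or_odd; omega
    refine ⟨by simpa using hfc p 1 hp le_rfl hp12 odd_one, fun r => ?_⟩
    rcases Nat.even_or_odd r with he | ho
    · have he2 : Even (r + 2) := he.add even_two
      have hdiv : (r + 2) / 2 = r / 2 + 1 := by omega
      rcases hp12 with h | h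
      · rw [heckePsi_natCast_zero p (-1) (by rw [h]; decide), hfa p _ hp (by omega) h he2, hdiv]
        rcases Nat.eq_zero_or_pos r with rfl | hr
        · simp [hf1]
        · rw [hfa p r hp hr h he]; push_cast; ring
      · rw [heckePsi_natCast_zero p 1 (by rw [h]; decide), hfb p _ hp (by omega) h he2]
        rcases Nat.eq_zero_or_pos r with rfl | hr
        · simp [hf1]
        · rw [hfb p r hp hr h he]; push_cast; ring
    · rw [hfc p (r + 2) hp (by omega) hp12 (ho.add_even even_two), hfc p r hp ho.pos hp12 ho,
        mul_zero]
  · intro p hp h1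
    obtain ⟨x, y, hx, hy, h⟩ := exists_pos_eq_sq_add_three_sq hp h1
    have hp2 : p % 2 = 1 := by
      rcases hp.eq_two_or_odd with rfl | h'
      · omega
      · exact h'
    refine ⟨x, y, by exact_mod_cast h.symm, ?_⟩
    rcases (by omega : p % 12 = 1 ∨ p % 12 = 7) with h12 | h12
    · refine ⟨by rw [hfg p x y hp h12 hx hy h, heckePsi_conj_of_one h12 h], fun r => ?_⟩
      rw [heckePsi_natCast_zero p 1 (by rw [h12]; decide), hfh p (r + 2) hp h12 (by omega)]
      simp
    · refine ⟨by rw [hfe p x y hp h12 hx hy h, heckePsi_conj_of_seven h12 h], fun r => ?_⟩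
      rw [heckePsi_natCast_zero p (-1) (by rw [h12]; decide), hff p (r + 2) hp h12 (by omega)]
      simp

theorem hasDerivAt_tsum_mul_exp {ι : Type*} {c ℓ : ι → ℂ}
    (h : ∀ R : ℝ, Summable fun i => ‖c i‖ * Real.exp (R * ‖ℓ i‖)) (s : ℂ) :
    HasDerivAt (fun s => ∑' i, c i * Complex.exp (ℓ i * s))
      (∑' i, c i * ℓ i * Complex.exp (ℓ i * s)) s := by
  have hnorm (i : ι) (y : ℂ) (hy : y ∈ Metric.ball (0 : ℂ) (‖s‖ + 1)) :
      ‖c i * ℓ i * Complex.exp (ℓ i * y)‖ ≤ ‖c i‖ * Real.exp ((‖s‖ + 2) * ‖ℓ i‖) := by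
    rw [norm_mul, norm_mul, Complex.norm_exp, mul_assoc]
    refine mul_le_mul_of_nonneg_left ?_ (norm_nonneg _)
    have h1 : ‖ℓ i‖ ≤ Real.exp ‖ℓ i‖ := (le_add_of_nonneg_right zero_le_one).trans
      (Real.add_one_le_exp _)
    have h2 : (ℓ i * y).re ≤ (‖s‖ + 1) * ‖ℓ i‖ := by
      refine (Complex.re_le_norm _).trans ?_
      rw [norm_mul, mul_comm]
      exact mul_le_mul_of_nonneg_right (mem_ball_zero_iff.1 hy).le (norm_nonneg _)
    calc ‖ℓ i‖ * Real.exp (ℓ i * y).re ≤ Real.exp ‖ℓ i‖ * Real.exp ((‖s‖ + 1) * ‖ℓ i‖) := by gcongr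
      _ = _ := by rw [← Real.exp_add]; ring_nf
  refine hasDerivAt_tsum_of_isPreconnected (g := fun i y => c i * Complex.exp (ℓ i * y))
    (g' := fun i y => c i * ℓ i * Complex.exp (ℓ i * y)) (h (‖s‖ + 2)) Metric.isOpen_ball
    (convex_ball (0 : ℂ) (‖s‖ + 1)).isPreconnected ?_ hnorm
    (Metric.mem_ball_self (by positivity)) ?_ (by simp)
  · intro i y _
    have := (((hasDerivAt_id y).const_mul (ℓ i)).cexp).const_mul (c i)
    simpa [mul_assoc, mul_comm, mul_left_comm] using this
  · refine Summable.of_norm ?_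
    simpa using h 0

theorem iteratedDeriv_tsum_mul_exp {ι : Type*} {c ℓ : ι → ℂ}
    (h : ∀ R : ℝ, Summable fun i => ‖c i‖ * Real.exp (R * ‖ℓ i‖)) (k : ℕ) :
    iteratedDeriv k (fun s => ∑' i, c i * Complex.exp (ℓ i * s)) =
      fun s => ∑' i, c i * ℓ i ^ k * Complex.exp (ℓ i * s) := by
  induction k with
  | zero => simp
  | succ k ih =>
    have hk (R : ℝ) : Summable fun i => ‖c i * ℓ i ^ k‖ * Real.exp (R * ‖ℓ i‖) := by
      refine Summable.of_nonneg_of_le (fun i => by positivity) (fun i => ?_) (h (R + k))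
      rw [norm_mul, norm_pow, mul_assoc]
      refine mul_le_mul_of_nonneg_left ?_ (norm_nonneg _)
      have h1 : ‖ℓ i‖ ≤ Real.exp ‖ℓ i‖ := (le_add_of_nonneg_right zero_le_one).trans
        (Real.add_one_le_exp _)
      calc ‖ℓ i‖ ^ k * Real.exp (R * ‖ℓ i‖) ≤ Real.exp ‖ℓ i‖ ^ k * Real.exp (R * ‖ℓ i‖) := by gcongr
        _ = _ := by rw [← Real.exp_nat_mul, ← Real.exp_add]; ring_nf
    rw [iteratedDeriv_succ, ih]
    funext s
    rw [(hasDerivAt_tsum_mul_exp hk s).deriv]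
    simp only [pow_succ, mul_assoc]

theorem summable_gaussian {T : ℝ} (hT : 0 < T) (R : ℝ) :
    Summable fun n : ℤ => Real.exp (R * |n| - T * n ^ 2) := by
  have := summable_pow_mul_jacobiTheta₂_term_bound (R / (2 * Real.pi))
    (T := T / Real.pi) (by positivity) 0
  refine this.congr fun n => ?_
  rw [pow_zero, one_mul]
  congr 1
  push_cast
  field_simp
  ring

theorem summable_gaussian_prod {T : ℝ} (hT : 0 < T) (R : ℝ) :
    Summable fun v : ℤ × ℤ =>
      Real.exp (R * (|v.1| + |v.2|) - T * ((v.1 : ℝ) ^ 2 + v.2 ^ 2)) := by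
  have := (summable_gaussian hT R).mul_of_nonneg (summable_gaussian hT R)
    (fun n => (Real.exp_pos _).le) (fun n => (Real.exp_pos _).le)
  refine this.congr fun v => ?_
  rw [← Real.exp_add]
  congr 1
  ring

/-- The odd function supported on `±1` modulo `M`. -/
noncomputable def oddSign (M : ℤ) (v : ℤ) : ℂ :=
  (if M ∣ v - 1 then 1 else 0) - (if M ∣ v + 1 then 1 else 0)

theorem norm_oddSign_le (M v : ℤ) : ‖oddSign M v‖ ≤ 1 := by
  unfold oddSign
  split_ifs <;> simp

theorem tsum_arith_progression {E : ℤ → ℂ} {M : ℤ} (hM : M ≠ 0) (r : ℤ) :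
    ∑' n : ℤ, E (M * n + r) = ∑' v : ℤ, (if M ∣ v - r then 1 else 0) * E v := by
  have hinj : Function.Injective fun n : ℤ => M * n + r := fun a b h => by
    simpa [hM] using h
  rw [← hinj.tsum_eq (f := fun v => (if M ∣ v - r then 1 else 0) * E v)]
  · simp
  · intro v hv
    have : M ∣ v - r := by
      by_contra h
      simp [h] at hv
    obtain ⟨k, hk⟩ := this
    exact ⟨k, by simp only; omega⟩

theorem summable_theta_dual {τ : ℂ} (hτ : 0 < τ.im) (z : ℂ) (M : ℤ) (hM : M ≠ 0) :
    Summable fun v : ℤ => ‖Complex.exp (2 * Real.pi * Complex.I * z * v / (M * τ) -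
      Real.pi * Complex.I * v ^ 2 / (M ^ 2 * τ))‖ := by
  have hτ0 : τ ≠ 0 := by rintro rfl; simp at hτ
  have hM' : (M : ℂ) ≠ 0 := by exact_mod_cast hM
  have hMr : (M : ℝ) ≠ 0 := by exact_mod_cast hM
  have h2 : 0 < (-1 / (M ^ 2 * τ)).im := by
    have : (-1 / ((M : ℂ) ^ 2 * τ)) = (((M : ℝ) ^ 2)⁻¹ : ℝ) * (-τ⁻¹) := by
      push_cast; field_simp
    rw [this, Complex.im_ofReal_mul, Complex.neg_im, Complex.inv_im, neg_div, neg_neg]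
    have := Complex.normSq_pos.2 hτ0
    positivity
  have := ((summable_jacobiTheta₂_term_iff (z / (M * τ)) (-1 / (M ^ 2 * τ))).2 h2).norm
  refine this.congr fun v => ?_
  rw [jacobiTheta₂_term]
  congr 2
  field_simp
  ring

theorem theta_dual_term {τ z : ℂ} (hτ0 : τ ≠ 0) {M : ℤ} (hM : (M : ℂ) ≠ 0) (r n : ℤ) :
    Complex.exp (-Real.pi * Complex.I * (z - r / M) ^ 2 / τ) *
      jacobiTheta₂_term n ((z - r / M) / τ) (-1 / τ) =
    Complex.exp (-Real.pi * Complex.I * z ^ 2 / τ) *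
      Complex.exp (2 * Real.pi * Complex.I * z * (M * n + r : ℤ) / (M * τ) -
        Real.pi * Complex.I * (M * n + r : ℤ) ^ 2 / (M ^ 2 * τ)) := by
  rw [jacobiTheta₂_term, ← Complex.exp_add, ← Complex.exp_add]
  congr 1
  push_cast
  field_simp
  ring

theorem jacobiTheta₂_sub {τ : ℂ} (hτ : 0 < τ.im) (z : ℂ) {M : ℤ} (hM : M ≠ 0) (r : ℤ) :
    jacobiTheta₂ (z - r / M) τ = 1 / (-Complex.I * τ) ^ (1 / 2 : ℂ) *
      Complex.exp (-Real.pi * Complex.I * z ^ 2 / τ) *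
      ∑' v : ℤ, (if M ∣ v - r then 1 else 0) * Complex.exp (2 * Real.pi * Complex.I * z * v /
        (M * τ) - Real.pi * Complex.I * v ^ 2 / (M ^ 2 * τ)) := by
  have hτ0 : τ ≠ 0 := by rintro rfl; simp at hτ
  have hM' : (M : ℂ) ≠ 0 := by exact_mod_cast hM
  rw [jacobiTheta₂_functional_equation, mul_assoc (1 / _), mul_assoc (1 / _)]
  congr 1
  rw [← tsum_arith_progression (E := fun v : ℤ => Complex.exp (2 * Real.pi * Complex.I * z * v /
        (M * τ) - Real.pi * Complex.I * v ^ 2 / (M ^ 2 * τ))) hM r, jacobiTheta₂, ← tsum_mul_left,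
    ← tsum_mul_left]
  exact tsum_congr fun n => theta_dual_term hτ0 hM' r n

theorem tsum_sin_mul_theta {τ : ℂ} (hτ : 0 < τ.im) (z : ℂ) {M : ℤ} (hM : M ≠ 0) :
    ∑' n : ℤ, (Complex.exp (2 * Real.pi * Complex.I * n / M) -
        Complex.exp (-(2 * Real.pi * Complex.I * n / M))) * jacobiTheta₂_term n z τ =
      -(1 / (-Complex.I * τ) ^ (1 / 2 : ℂ) * Complex.exp (-Real.pi * Complex.I * z ^ 2 / τ) *
      ∑' v : ℤ, oddSign M v * Complex.exp (2 * Real.pi * Complex.I * z * v /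
        (M * τ) - Real.pi * Complex.I * v ^ 2 / (M ^ 2 * τ))) := by
  have h1 := jacobiTheta₂_sub hτ z hM 1
  have h2 := jacobiTheta₂_sub hτ z hM (-1)
  have hs (r : ℤ) : Summable fun v : ℤ => (if M ∣ v - r then (1 : ℂ) else 0) *
      Complex.exp (2 * Real.pi * Complex.I * z * v /
        (M * τ) - Real.pi * Complex.I * v ^ 2 / (M ^ 2 * τ)) := by
    refine Summable.of_norm_bounded (summable_theta_dual hτ z M hM) fun v => ?_
    split_ifs <;> simp
  have hlhs : jacobiTheta₂ (z - (-1 : ℤ) / M) τ - jacobiTheta₂ (z - (1 : ℤ) / M) τ =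
      ∑' n : ℤ, (Complex.exp (2 * Real.pi * Complex.I * n / M) -
        Complex.exp (-(2 * Real.pi * Complex.I * n / M))) * jacobiTheta₂_term n z τ := by
    rw [jacobiTheta₂, jacobiTheta₂, ← Summable.tsum_sub
      ((summable_jacobiTheta₂_term_iff _ _).2 hτ) ((summable_jacobiTheta₂_term_iff _ _).2 hτ)]
    refine tsum_congr fun n => ?_
    simp only [jacobiTheta₂_term]
    rw [sub_mul, ← Complex.exp_add, ← Complex.exp_add]
    congr 2 <;> (push_cast; ring)
  rw [← hlhs, h1, h2, ← mul_sub, ← Summable.tsum_sub (hs _) (hs _), ← mul_neg, ← tsum_neg]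
  congr 1
  refine tsum_congr fun v => ?_
  rw [oddSign, sub_neg_eq_add]
  ring

theorem summable_theta_coeff {τ : ℂ} (hτ : 0 < τ.im) {c : ℤ × ℤ → ℂ} {K : ℝ}
    (hc : ∀ v, ‖c v‖ ≤ K) {A B : ℝ} (hA : 0 < A) (hB : 0 < B) (α β : ℂ) (R : ℝ) :
    Summable fun v : ℤ × ℤ =>
      ‖c v * Complex.exp (Real.pi * Complex.I * (A * v.1 ^ 2 + B * v.2 ^ 2) * τ)‖ *
        Real.exp (R * ‖α * v.1 + β * v.2‖) := by
  set T := Real.pi * min A B * τ.im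
  have hT : 0 < T := by have := lt_min hA hB; positivity
  refine Summable.of_nonneg_of_le (fun v => by positivity) (fun v => ?_)
    ((summable_gaussian_prod hT (|R| * (‖α‖ + ‖β‖))).mul_left K)
  have hexp : ‖Complex.exp (Real.pi * Complex.I * (A * v.1 ^ 2 + B * v.2 ^ 2) * τ)‖ =
      Real.exp (-(Real.pi * τ.im * (A * (v.1 : ℝ) ^ 2 + B * (v.2 : ℝ) ^ 2))) := by
    rw [Complex.norm_exp]
    congr 1
    have : (Real.pi * Complex.I * (A * v.1 ^ 2 + B * v.2 ^ 2) * τ : ℂ) =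
        ((Real.pi * (A * (v.1 : ℝ) ^ 2 + B * (v.2 : ℝ) ^ 2) : ℝ) : ℂ) * (Complex.I * τ) := by
      push_cast; ring
    rw [this, Complex.re_ofReal_mul, Complex.I_mul_re]
    ring
  rw [norm_mul, hexp, mul_assoc, ← Real.exp_add]
  have hK : 0 ≤ K := (norm_nonneg _).trans (hc 0)
  refine mul_le_mul (hc v) (Real.exp_le_exp.2 ?_) (Real.exp_pos _).le hK
  have h1 : R * ‖α * v.1 + β * v.2‖ ≤ |R| * ((‖α‖ + ‖β‖) * (|v.1| + |v.2| : ℤ)) := by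
    refine (mul_le_mul_of_nonneg_right (le_abs_self R) (norm_nonneg _)).trans ?_
    refine mul_le_mul_of_nonneg_left ?_ (abs_nonneg R)
    refine (norm_add_le _ _).trans ?_
    rw [norm_mul, norm_mul, Complex.norm_intCast, Complex.norm_intCast]
    push_cast
    have := mul_nonneg (norm_nonneg α) (abs_nonneg (v.2 : ℝ))
    have := mul_nonneg (norm_nonneg β) (abs_nonneg (v.1 : ℝ))
    nlinarith
  have h2 : T * ((v.1 : ℝ) ^ 2 + (v.2 : ℝ) ^ 2) ≤
      Real.pi * τ.im * (A * (v.1 : ℝ) ^ 2 + B * (v.2 : ℝ) ^ 2) := by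
    have h3 : min A B * ((v.1 : ℝ) ^ 2 + (v.2 : ℝ) ^ 2) ≤
        A * (v.1 : ℝ) ^ 2 + B * (v.2 : ℝ) ^ 2 := by
      have := mul_le_mul_of_nonneg_right (min_le_left A B) (sq_nonneg (v.1 : ℝ))
      have := mul_le_mul_of_nonneg_right (min_le_right A B) (sq_nonneg (v.2 : ℝ))
      linarith
    have := mul_le_mul_of_nonneg_left h3 (mul_pos Real.pi_pos hτ).le
    calc _ = Real.pi * τ.im * (min A B * ((v.1 : ℝ) ^ 2 + (v.2 : ℝ) ^ 2)) := by
            simp only [T]; ring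
      _ ≤ _ := this
  rw [← mul_assoc] at h1
  push_cast at h1 ⊢
  linarith

/-- The coefficient `2 i sin (2πn/M)`. -/
noncomputable def sinCoeff (M n : ℤ) : ℂ :=
  Complex.exp (2 * Real.pi * Complex.I * n / M) - Complex.exp (-(2 * Real.pi * Complex.I * n / M))

theorem norm_sinCoeff_le (M n : ℤ) : ‖sinCoeff M n‖ ≤ 2 := by
  have h (x : ℝ) : ‖Complex.exp (x * Complex.I)‖ = 1 := Complex.norm_exp_ofReal_mul_I x
  have h1 := h (2 * Real.pi * n / M)
  have h2 := h (-(2 * Real.pi * n / M))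
  have e1 : (2 * Real.pi * Complex.I * n / M : ℂ) = (2 * Real.pi * n / M : ℝ) * Complex.I := by
    push_cast; ring
  have e2 : (-(2 * Real.pi * Complex.I * n / M) : ℂ) =
      (-(2 * Real.pi * n / M) : ℝ) * Complex.I := by push_cast; ring
  rw [sinCoeff]
  refine (norm_sub_le _ _).trans ?_
  rw [e2, e1, h1, h2]
  norm_num

theorem cpow_half_mul_cpow_half {τ : ℂ} (hτ : 0 < τ.im) :
    1 / (-Complex.I * (2 / 3 * τ)) ^ (1 / 2 : ℂ) * (1 / (-Complex.I * (1 / 2 * τ)) ^ (1 / 2 : ℂ)) =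
      Real.sqrt 3 * (Complex.I / τ) := by
  have hτ0 : τ ≠ 0 := by rintro rfl; simp at hτ
  have hre : 0 < (-Complex.I * τ).re := by simpa using hτ
  have hne : -Complex.I * τ ≠ 0 := by intro h; rw [h] at hre; simp at hre
  have key (r : ℝ) (hr : 0 < r) : (-Complex.I * (r * τ)) ^ (1 / 2 : ℂ) =
      (Real.sqrt r : ℂ) * (-Complex.I * τ) ^ (1 / 2 : ℂ) := by
    have : -Complex.I * (r * τ) = (r : ℂ) * (-Complex.I * τ) := by ring
    have hr0 : (r : ℂ) ≠ 0 := Complex.ofReal_ne_zero.2 hr.ne'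
    have hsqrt : (Real.sqrt r : ℂ) = (r : ℂ) ^ (1 / 2 : ℂ) := by
      rw [Real.sqrt_eq_rpow, Complex.ofReal_cpow hr.le]; norm_num
    rw [this, hsqrt, Complex.cpow_def_of_ne_zero (mul_ne_zero hr0 hne),
      Complex.cpow_def_of_ne_zero hr0, Complex.cpow_def_of_ne_zero hne,
      Complex.log_ofReal_mul hr hne, ← Complex.exp_add, ← Complex.ofReal_log hr.le, add_mul]
  have h1 := key (2 / 3) (by norm_num)
  have h2 := key (1 / 2) (by norm_num)
  push_cast at h1 h2
  rw [h1, h2]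
  have hsq : (-Complex.I * τ) ^ (1 / 2 : ℂ) * (-Complex.I * τ) ^ (1 / 2 : ℂ) = -Complex.I * τ := by
    rw [← Complex.cpow_add _ _ hne]; norm_num
  have hr : (Real.sqrt (2 / 3) * Real.sqrt (1 / 2) * Real.sqrt 3 : ℝ) = 1 := by
    rw [← Real.sqrt_mul (by norm_num), ← Real.sqrt_mul (by norm_num)]; norm_num
  have hrC : ((Real.sqrt (2 / 3) : ℂ) * Real.sqrt (1 / 2) * Real.sqrt 3) = 1 := by
    exact_mod_cast hr
  have hprod : (Real.sqrt (2 / 3) : ℂ) * (-Complex.I * τ) ^ (1 / 2 : ℂ) *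
      ((Real.sqrt (1 / 2) : ℂ) * (-Complex.I * τ) ^ (1 / 2 : ℂ)) * (Real.sqrt 3 * (Complex.I / τ)) =
      1 := by
    calc _ = ((Real.sqrt (2 / 3) : ℂ) * Real.sqrt (1 / 2) * Real.sqrt 3) *
        ((-Complex.I * τ) ^ (1 / 2 : ℂ) * (-Complex.I * τ) ^ (1 / 2 : ℂ)) * (Complex.I / τ) := by ring
      _ = 1 := by
        rw [hrC, hsq]
        field_simp
        rw [Complex.I_sq]; ring
  rw [one_div_mul_one_div]
  exact (eq_one_div_of_mul_eq_one_right hprod).symm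

theorem tsum_theta_prod {τ : ℂ} (hτ : 0 < τ.im) (s : ℂ) :
    ∑' v : ℤ × ℤ, sinCoeff 6 v.1 * sinCoeff 4 v.2 *
        Complex.exp (Real.pi * Complex.I * ((2 / 3 : ℝ) * v.1 ^ 2 + (1 / 2 : ℝ) * v.2 ^ 2) * τ) *
        Complex.exp (2 * Real.pi * Complex.I * (2 * v.1 + rootNegThree * v.2) * s) =
      Real.sqrt 3 * (Complex.I / τ) * ∑' v : ℤ × ℤ, oddSign 6 v.1 * oddSign 4 v.2 *
        Complex.exp (Real.pi * Complex.I * ((1 / 24 : ℝ) * v.1 ^ 2 + (1 / 8 : ℝ) * v.2 ^ 2) *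
          (-1 / τ)) *
        Complex.exp (Real.pi * Complex.I / τ * (v.1 + rootNegThree * v.2) * s) := by
  have hτ0 : τ ≠ 0 := by rintro rfl; simp at hτ
  have hτ1 : 0 < (2 / 3 * τ).im := by
    rw [show (2 / 3 * τ) = ((2 / 3 : ℝ) : ℂ) * τ by push_cast; ring, Complex.im_ofReal_mul]
    positivity
  have hτ2 : 0 < (1 / 2 * τ).im := by
    rw [show (1 / 2 * τ) = ((1 / 2 : ℝ) : ℂ) * τ by push_cast; ring, Complex.im_ofReal_mul]
    positivity
  have e1 := tsum_sin_mul_theta hτ1 (2 * s) (M := 6) (by norm_num)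
  have e2 := tsum_sin_mul_theta hτ2 (rootNegThree * s) (M := 4) (by norm_num)
  have hs {σ : ℂ} (hσ : 0 < σ.im) (z : ℂ) (M : ℤ) :
      Summable fun n : ℤ => ‖sinCoeff M n * jacobiTheta₂_term n z σ‖ := by
    refine Summable.of_nonneg_of_le (fun n => norm_nonneg _) (fun n => ?_)
      (((summable_jacobiTheta₂_term_iff z σ).2 hσ).norm.mul_left 2)
    rw [norm_mul]
    exact mul_le_mul_of_nonneg_right (norm_sinCoeff_le M n) (norm_nonneg _)
  have hs' {σ : ℂ} (hσ : 0 < σ.im) (z : ℂ) (M : ℤ) (hM : M ≠ 0) :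
      Summable fun v : ℤ => ‖oddSign M v * Complex.exp (2 * Real.pi * Complex.I * z * v / (M * σ) -
        Real.pi * Complex.I * v ^ 2 / (M ^ 2 * σ))‖ := by
    refine Summable.of_nonneg_of_le (fun n => norm_nonneg _) (fun n => ?_)
      (summable_theta_dual hσ z M hM)
    rw [norm_mul]
    exact mul_le_of_le_one_left (norm_nonneg _) (norm_oddSign_le M n)
  have hmul := congrArg₂ (· * ·) e1 e2
  have hl := tsum_mul_tsum_of_summable_norm (hs hτ1 (2 * s) 6) (hs hτ2 (rootNegThree * s) 4)
  have hr := tsum_mul_tsum_of_summable_norm (hs' hτ1 (2 * s) 6 (by norm_num))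
    (hs' hτ2 (rootNegThree * s) 4 (by norm_num))
  have hcancel : Complex.exp (-Real.pi * Complex.I * (2 * s) ^ 2 / (2 / 3 * τ)) *
      Complex.exp (-Real.pi * Complex.I * (rootNegThree * s) ^ 2 / (1 / 2 * τ)) = 1 := by
    rw [← Complex.exp_add, mul_pow rootNegThree, rootNegThree_sq]
    refine (congrArg Complex.exp ?_).trans Complex.exp_zero
    field_simp
    ring
  have hlhs : ∑' v : ℤ × ℤ, sinCoeff 6 v.1 * sinCoeff 4 v.2 *
        Complex.exp (Real.pi * Complex.I * ((2 / 3 : ℝ) * v.1 ^ 2 + (1 / 2 : ℝ) * v.2 ^ 2) * τ) *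
        Complex.exp (2 * Real.pi * Complex.I * (2 * v.1 + rootNegThree * v.2) * s) =
      ∑' v : ℤ × ℤ, (sinCoeff 6 v.1 * jacobiTheta₂_term v.1 (2 * s) (2 / 3 * τ)) *
        (sinCoeff 4 v.2 * jacobiTheta₂_term v.2 (rootNegThree * s) (1 / 2 * τ)) := by
    refine tsum_congr fun v => ?_
    rw [mul_mul_mul_comm, mul_assoc, jacobiTheta₂_term, jacobiTheta₂_term, ← Complex.exp_add,
      ← Complex.exp_add]
    congr 2
    push_cast
    ring
  have hrhs : ∑' v : ℤ × ℤ, oddSign 6 v.1 * oddSign 4 v.2 *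
        Complex.exp (Real.pi * Complex.I * ((1 / 24 : ℝ) * v.1 ^ 2 + (1 / 8 : ℝ) * v.2 ^ 2) *
          (-1 / τ)) *
        Complex.exp (Real.pi * Complex.I / τ * (v.1 + rootNegThree * v.2) * s) =
      ∑' v : ℤ × ℤ, (oddSign 6 v.1 * Complex.exp (2 * Real.pi * Complex.I * (2 * s) * v.1 /
          ((6 : ℤ) * (2 / 3 * τ)) - Real.pi * Complex.I * v.1 ^ 2 / ((6 : ℤ) ^ 2 * (2 / 3 * τ)))) *
        (oddSign 4 v.2 * Complex.exp (2 * Real.pi * Complex.I * (rootNegThree * s) * v.2 /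
          ((4 : ℤ) * (1 / 2 * τ)) - Real.pi * Complex.I * v.2 ^ 2 / ((4 : ℤ) ^ 2 * (1 / 2 * τ)))) := by
    refine tsum_congr fun v => ?_
    rw [mul_mul_mul_comm, mul_assoc, ← Complex.exp_add, ← Complex.exp_add]
    congr 2
    push_cast
    field_simp
    ring
  rw [hlhs, hrhs, ← hl, ← hr, ← cpow_half_mul_cpow_half hτ]
  refine hmul.trans ?_
  linear_combination (1 / (-Complex.I * (2 / 3 * τ)) ^ (1 / 2 : ℂ) *
    (1 / (-Complex.I * (1 / 2 * τ)) ^ (1 / 2 : ℂ)) *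
    (∑' v : ℤ, oddSign 6 v * Complex.exp (2 * Real.pi * Complex.I * (2 * s) * v /
          ((6 : ℤ) * (2 / 3 * τ)) - Real.pi * Complex.I * v ^ 2 / ((6 : ℤ) ^ 2 * (2 / 3 * τ)))) *
    ∑' v : ℤ, oddSign 4 v * Complex.exp (2 * Real.pi * Complex.I * (rootNegThree * s) * v /
          ((4 : ℤ) * (1 / 2 * τ)) - Real.pi * Complex.I * v ^ 2 / ((4 : ℤ) ^ 2 * (1 / 2 * τ)))) *
    hcancel

theorem tsum_theta_prod_pow_six {τ : ℂ} (hτ : 0 < τ.im) :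
    ∑' v : ℤ × ℤ, sinCoeff 6 v.1 * sinCoeff 4 v.2 *
        Complex.exp (Real.pi * Complex.I * ((2 / 3 : ℝ) * v.1 ^ 2 + (1 / 2 : ℝ) * v.2 ^ 2) * τ) *
        (2 * v.1 + rootNegThree * v.2) ^ 6 =
      Real.sqrt 3 * (Complex.I / τ ^ 7) * ∑' v : ℤ × ℤ, oddSign 6 v.1 * oddSign 4 v.2 *
        Complex.exp (Real.pi * Complex.I * ((1 / 24 : ℝ) * v.1 ^ 2 + (1 / 8 : ℝ) * v.2 ^ 2) *
          (-1 / τ)) * ((v.1 + rootNegThree * v.2) / 2) ^ 6 := by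
  have hτ0 : τ ≠ 0 := by rintro rfl; simp at hτ
  have hσ : 0 < (-1 / τ).im := by
    rw [neg_div, one_div, Complex.neg_im, Complex.inv_im, neg_div, neg_neg]
    have := Complex.normSq_pos.2 hτ0
    positivity
  have hl (R : ℝ) := summable_theta_coeff hτ (c := fun v => sinCoeff 6 v.1 * sinCoeff 4 v.2)
    (K := 4) (fun v => by
      rw [norm_mul]
      nlinarith [norm_sinCoeff_le 6 v.1, norm_sinCoeff_le 4 v.2, norm_nonneg (sinCoeff 6 v.1),
        norm_nonneg (sinCoeff 4 v.2)])
    (A := 2 / 3) (B := 1 / 2) (by norm_num) (by norm_num) (2 * Real.pi * Complex.I * 2)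
    (2 * Real.pi * Complex.I * rootNegThree) R
  have hr (R : ℝ) := summable_theta_coeff hσ (c := fun v => oddSign 6 v.1 * oddSign 4 v.2)
    (K := 1) (fun v => by
      rw [norm_mul]
      exact mul_le_one₀ (norm_oddSign_le 6 v.1) (norm_nonneg _) (norm_oddSign_le 4 v.2))
    (A := 1 / 24) (B := 1 / 8) (by norm_num) (by norm_num) (Real.pi * Complex.I / τ)
    (Real.pi * Complex.I / τ * rootNegThree) R
  have hl6 := congrFun (iteratedDeriv_tsum_mul_exp hl 6) 0
  have hr6 := congrFun (iteratedDeriv_tsum_mul_exp hr 6) 0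
  have hfun : (fun s : ℂ => ∑' v : ℤ × ℤ, sinCoeff 6 v.1 * sinCoeff 4 v.2 *
        Complex.exp (Real.pi * Complex.I * ((2 / 3 : ℝ) * v.1 ^ 2 + (1 / 2 : ℝ) * v.2 ^ 2) * τ) *
        Complex.exp ((2 * Real.pi * Complex.I * 2 * v.1 +
          2 * Real.pi * Complex.I * rootNegThree * v.2) * s)) = fun s =>
      Real.sqrt 3 * (Complex.I / τ) * ∑' v : ℤ × ℤ, oddSign 6 v.1 * oddSign 4 v.2 *
        Complex.exp (Real.pi * Complex.I * ((1 / 24 : ℝ) * v.1 ^ 2 + (1 / 8 : ℝ) * v.2 ^ 2) *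
          (-1 / τ)) * Complex.exp ((Real.pi * Complex.I / τ * v.1 +
          Real.pi * Complex.I / τ * rootNegThree * v.2) * s) := by
    funext s
    have := tsum_theta_prod hτ s
    simp only [mul_add, mul_assoc] at this ⊢
    exact this
  rw [hfun, iteratedDeriv_const_mul_field, hr6] at hl6
  simp only [mul_zero, Complex.exp_zero, mul_one] at hl6
  have hc : (2 * Real.pi * Complex.I : ℂ) ^ 6 ≠ 0 :=
    pow_ne_zero _ Complex.two_pi_I_ne_zero
  rw [← mul_right_inj' hc, ← tsum_mul_left]
  trans Real.sqrt 3 * (Complex.I / τ) * ∑' v : ℤ × ℤ, oddSign 6 v.1 * oddSign 4 v.2 *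
        Complex.exp (Real.pi * Complex.I * ((1 / 24 : ℝ) * v.1 ^ 2 + (1 / 8 : ℝ) * v.2 ^ 2) *
          (-1 / τ)) * (Real.pi * Complex.I / τ * v.1 +
          Real.pi * Complex.I / τ * rootNegThree * v.2) ^ 6
  · rw [hl6]
    exact tsum_congr fun v => by ring
  · rw [← tsum_mul_left, ← tsum_mul_left, ← tsum_mul_left]
    refine tsum_congr fun v => ?_
    field_simp

/-- The restriction of `heckeChi` to even `x`. -/
def evenChi (x y : ℤ) : ℤ := if x % 2 = 0 then heckeChi x y else 0

/-- The theta series of weight `7` attached to `evenChi`. -/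
noncomputable def thetaSeven (τ : ℂ) : ℂ :=
  ∑' v : ℤ × ℤ, evenChi v.1 v.2 * ((v.1 : ℂ) + v.2 * rootNegThree) ^ 6 *
    Complex.exp (2 * Real.pi * Complex.I * τ * (normThree v / 12))

theorem sinCoeff_eq (M n : ℤ) : sinCoeff M n = 2 * Complex.I * Real.sin (2 * Real.pi * n / M) := by
  rw [Complex.ofReal_sin, Complex.sin, sinCoeff]
  have e1 : (2 * Real.pi * Complex.I * n / M : ℂ) =
      ((2 * Real.pi * n / M : ℝ) : ℂ) * Complex.I := by push_cast; ring
  rw [e1, neg_mul]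
  linear_combination (Complex.exp (((2 * Real.pi * n / M : ℝ) : ℂ) * Complex.I) -
    Complex.exp (-(((2 * Real.pi * n / M : ℝ) : ℂ) * Complex.I))) * Complex.I_sq

theorem sin_two_pi_mul_div_emod {M : ℤ} (hM : M ≠ 0) (n : ℤ) :
    Real.sin (2 * Real.pi * n / M) = Real.sin (2 * Real.pi * (n % M : ℤ) / M) := by
  have hM' : (M : ℝ) ≠ 0 := by exact_mod_cast hM
  rw [← Real.sin_add_int_mul_two_pi (2 * Real.pi * (n % M : ℤ) / M) (n / M)]
  congr 1
  have h : ((n % M : ℤ) : ℝ) + M * (n / M : ℤ) = n := by exact_mod_cast Int.emod_add_mul_ediv n M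
  rw [← h]
  field_simp

theorem sinCoeff_six (u : ℤ) : sinCoeff 6 u = rootNegThree *
    ((if u % 6 = 1 ∨ u % 6 = 2 then 1 else if u % 6 = 4 ∨ u % 6 = 5 then -1 else 0 : ℤ) : ℂ) := by
  have h3 : Real.sin (Real.pi / 3) = Real.sqrt 3 / 2 := Real.sin_pi_div_three
  rw [sinCoeff_eq, sin_two_pi_mul_div_emod (by norm_num), rootNegThree]
  have h0 := Int.emod_nonneg u (show (6 : ℤ) ≠ 0 by norm_num)
  have h6 := Int.emod_lt_of_pos u (show (0 : ℤ) < 6 by norm_num)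
  have key : Real.sin (2 * Real.pi * (u % 6 : ℤ) / (6 : ℤ)) = Real.sqrt 3 / 2 *
    ((if u % 6 = 1 ∨ u % 6 = 2 then 1 else if u % 6 = 4 ∨ u % 6 = 5 then -1 else 0 : ℤ) : ℝ) := by
    generalize u % 6 = r at *
    interval_cases r
    · simp
    · rw [show 2 * Real.pi * ((1 : ℤ) : ℝ) / (6 : ℤ) = Real.pi / 3 by push_cast; ring, h3]; simp
    · rw [show 2 * Real.pi * ((2 : ℤ) : ℝ) / (6 : ℤ) = Real.pi - Real.pi / 3 by push_cast; ring,
        Real.sin_pi_sub, h3]; simp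
    · rw [show 2 * Real.pi * ((3 : ℤ) : ℝ) / (6 : ℤ) = Real.pi by push_cast; ring]; simp
    · rw [show 2 * Real.pi * ((4 : ℤ) : ℝ) / (6 : ℤ) = Real.pi / 3 + Real.pi by push_cast; ring,
        Real.sin_add_pi, h3]; simp
    · rw [show 2 * Real.pi * ((5 : ℤ) : ℝ) / (6 : ℤ) = -(Real.pi / 3) + 2 * Real.pi by
        push_cast; ring, Real.sin_add_two_pi, Real.sin_neg, h3]; simp
  rw [key]
  simp only [Complex.ofReal_mul, Complex.ofReal_intCast, Complex.ofReal_div, Complex.ofReal_ofNat]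
  ring

theorem sinCoeff_four (y : ℤ) : sinCoeff 4 y = 2 * Complex.I *
    ((if y % 4 = 1 then 1 else if y % 4 = 3 then -1 else 0 : ℤ) : ℂ) := by
  rw [sinCoeff_eq, sin_two_pi_mul_div_emod (by norm_num)]
  have h0 := Int.emod_nonneg y (show (4 : ℤ) ≠ 0 by norm_num)
  have h4 := Int.emod_lt_of_pos y (show (0 : ℤ) < 4 by norm_num)
  have key : Real.sin (2 * Real.pi * (y % 4 : ℤ) / (4 : ℤ)) =
    ((if y % 4 = 1 then 1 else if y % 4 = 3 then -1 else 0 : ℤ) : ℝ) := by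
    generalize y % 4 = r at *
    interval_cases r
    · simp
    · rw [show 2 * Real.pi * ((1 : ℤ) : ℝ) / (4 : ℤ) = Real.pi / 2 by push_cast; ring]; simp
    · rw [show 2 * Real.pi * ((2 : ℤ) : ℝ) / (4 : ℤ) = Real.pi by push_cast; ring]; simp
    · rw [show 2 * Real.pi * ((3 : ℤ) : ℝ) / (4 : ℤ) = Real.pi / 2 + Real.pi by push_cast; ring,
        Real.sin_add_pi]; simp
  rw [key, Complex.ofReal_intCast]

theorem heckeChi_two_mul_fin : ∀ u y : Fin 12, heckeChi (2 * ((u : ℕ) : ℤ)) ((y : ℕ) : ℤ) =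
    -((if ((u : ℕ) : ℤ) % 6 = 1 ∨ ((u : ℕ) : ℤ) % 6 = 2 then 1
      else if ((u : ℕ) : ℤ) % 6 = 4 ∨ ((u : ℕ) : ℤ) % 6 = 5 then -1 else 0) *
    (if ((y : ℕ) : ℤ) % 4 = 1 then 1 else if ((y : ℕ) : ℤ) % 4 = 3 then -1 else 0)) := by decide

theorem exists_fin_twelve (x : ℤ) : ∃ r : Fin 12, x % 12 = ((r : ℕ) : ℤ) := by
  refine ⟨⟨(x % 12).toNat, by omega⟩, ?_⟩
  simp only
  omega

theorem heckeChi_congr {x y z w : ℤ} (h : x % 12 = z % 12) (h' : y % 12 = w % 12) :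
    heckeChi x y = heckeChi z w := by
  rw [← heckeChi_mod, h, h', heckeChi_mod]

theorem heckeChi_two_mul (u y : ℤ) : heckeChi (2 * u) y =
    -((if u % 6 = 1 ∨ u % 6 = 2 then 1 else if u % 6 = 4 ∨ u % 6 = 5 then -1 else 0) *
    (if y % 4 = 1 then 1 else if y % 4 = 3 then -1 else 0)) := by
  obtain ⟨r, hr⟩ := exists_fin_twelve u
  obtain ⟨t, ht⟩ := exists_fin_twelve y
  have h := heckeChi_two_mul_fin r t
  rw [← hr, ← ht, Int.emod_emod_of_dvd _ (by norm_num : (6 : ℤ) ∣ 12),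
    Int.emod_emod_of_dvd _ (by norm_num : (4 : ℤ) ∣ 12)] at h
  rw [← h]
  exact heckeChi_congr (by omega) (by omega)

theorem sinCoeff_mul_sinCoeff (u y : ℤ) :
    sinCoeff 6 u * sinCoeff 4 y = 2 * Real.sqrt 3 * (evenChi (2 * u) y : ℂ) := by
  have he : evenChi (2 * u) y = heckeChi (2 * u) y := if_pos (by omega)
  rw [sinCoeff_six, sinCoeff_four, he, heckeChi_two_mul, rootNegThree,
    Int.cast_neg, Int.cast_mul]
  linear_combination (2 * Real.sqrt 3 *
    ((if u % 6 = 1 ∨ u % 6 = 2 then 1 else if u % 6 = 4 ∨ u % 6 = 5 then -1 else 0 : ℤ) : ℂ) *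
    ((if y % 4 = 1 then 1 else if y % 4 = 3 then -1 else 0 : ℤ) : ℂ)) * Complex.I_sq

theorem tsum_sinCoeff_eq (τ : ℂ) :
    ∑' v : ℤ × ℤ, sinCoeff 6 v.1 * sinCoeff 4 v.2 *
        Complex.exp (Real.pi * Complex.I * ((2 / 3 : ℝ) * v.1 ^ 2 + (1 / 2 : ℝ) * v.2 ^ 2) * τ) *
        (2 * v.1 + rootNegThree * v.2) ^ 6 = 2 * Real.sqrt 3 * thetaSeven τ := by
  have hinj : Function.Injective fun v : ℤ × ℤ => (2 * v.1, v.2) := by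
    rintro ⟨a, b⟩ ⟨c, d⟩ h
    simp only [Prod.mk.injEq] at h ⊢
    omega
  rw [thetaSeven, ← hinj.tsum_eq (f := fun v : ℤ × ℤ => (evenChi v.1 v.2 : ℂ) *
    ((v.1 : ℂ) + v.2 * rootNegThree) ^ 6 *
    Complex.exp (2 * Real.pi * Complex.I * τ * (normThree v / 12))), ← tsum_mul_left]
  · refine tsum_congr fun v => ?_
    rw [sinCoeff_mul_sinCoeff]
    have he : Complex.exp (Real.pi * Complex.I * ((2 / 3 : ℝ) * v.1 ^ 2 + (1 / 2 : ℝ) * v.2 ^ 2) * τ)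
        = Complex.exp (2 * Real.pi * Complex.I * τ * (normThree (2 * v.1, v.2) / 12)) := by
      congr 1
      simp only [normThree]
      push_cast
      ring
    rw [he]
    push_cast
    ring
  · rintro ⟨x, y⟩ hv
    have : x % 2 = 0 := by
      by_contra h
      have h0 : evenChi x y = 0 := if_neg h
      exact hv (by simp [h0])
    exact ⟨(x / 2, y), by simp only [Prod.mk.injEq, and_true]; omega⟩

/-- The integral version of `oddSign`. -/
def oddSignInt (M v : ℤ) : ℤ := (if M ∣ v - 1 then 1 else 0) - (if M ∣ v + 1 then 1 else 0)

theorem oddSign_eq (M v : ℤ) : oddSign M v = oddSignInt M v := by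
  rw [oddSign, oddSignInt]; push_cast; rfl

theorem oddSignInt_fin : ∀ x y : Fin 12,
    oddSignInt 6 (-((x : ℕ) : ℤ) - 3 * ((y : ℕ) : ℤ)) * oddSignInt 4 (((x : ℕ) : ℤ) - ((y : ℕ) : ℤ)) +
    oddSignInt 6 (-((x : ℕ) : ℤ) + 3 * ((y : ℕ) : ℤ)) * oddSignInt 4 (-((x : ℕ) : ℤ) - ((y : ℕ) : ℤ)) =
    -2 * evenChi ((x : ℕ) : ℤ) ((y : ℕ) : ℤ) := by decide

theorem oddSignInt_congr {M v w : ℤ} (h : M ∣ v - w) : oddSignInt M v = oddSignInt M w := by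
  have h1 : M ∣ v - 1 ↔ M ∣ w - 1 := by
    rw [show v - 1 = (v - w) + (w - 1) by ring]; exact Int.dvd_add_right h
  have h2 : M ∣ v + 1 ↔ M ∣ w + 1 := by
    rw [show v + 1 = (v - w) + (w + 1) by ring]; exact Int.dvd_add_right h
  simp only [oddSignInt, h1, h2]

theorem oddSignInt_add (x y : ℤ) :
    oddSignInt 6 (-x - 3 * y) * oddSignInt 4 (x - y) +
    oddSignInt 6 (-x + 3 * y) * oddSignInt 4 (-x - y) = -2 * evenChi x y := by
  obtain ⟨r, hr⟩ := exists_fin_twelve x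
  obtain ⟨t, ht⟩ := exists_fin_twelve y
  have h := oddSignInt_fin r t
  rw [← hr, ← ht] at h
  have he : evenChi (x % 12) (y % 12) = evenChi x y := by
    rw [evenChi, evenChi, heckeChi_mod, Int.emod_emod_of_dvd _ (by norm_num : (2 : ℤ) ∣ 12)]
  rw [he] at h
  rw [← h]
  congr 2 <;> exact oddSignInt_congr (by omega)

theorem norm_evenChi_le (x y : ℤ) : ‖(evenChi x y : ℂ)‖ ≤ 1 := by
  have h12 : ∀ r t : Fin 12, |evenChi ((r : ℕ) : ℤ) ((t : ℕ) : ℤ)| ≤ 1 := by decide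
  obtain ⟨r, hr⟩ := exists_fin_twelve x
  obtain ⟨t, ht⟩ := exists_fin_twelve y
  have h := h12 r t
  have he : evenChi (x % 12) (y % 12) = evenChi x y := by
    rw [evenChi, evenChi, heckeChi_mod, Int.emod_emod_of_dvd _ (by norm_num : (2 : ℤ) ∣ 12)]
  rw [← hr, ← ht, he] at h
  rw [Complex.norm_intCast]
  exact_mod_cast h

theorem norm_pow_six_le (z : ℂ) : ‖z‖ ^ 6 ≤ Real.exp (6 * ‖z‖) := by
  have h1 : ‖z‖ ≤ Real.exp ‖z‖ := (le_add_of_nonneg_right zero_le_one).trans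
    (Real.add_one_le_exp _)
  calc ‖z‖ ^ 6 ≤ Real.exp ‖z‖ ^ 6 := by gcongr
    _ = _ := by rw [← Real.exp_nat_mul]; norm_num

theorem summable_theta_pow_six {τ : ℂ} (hτ : 0 < τ.im) {c : ℤ × ℤ → ℂ} {K : ℝ}
    (hc : ∀ v, ‖c v‖ ≤ K) {A B : ℝ} (hA : 0 < A) (hB : 0 < B) (α β : ℂ) :
    Summable fun v : ℤ × ℤ =>
      c v * Complex.exp (Real.pi * Complex.I * (A * v.1 ^ 2 + B * v.2 ^ 2) * τ) *
        (α * v.1 + β * v.2) ^ 6 := by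
  refine Summable.of_norm_bounded (summable_theta_coeff hτ hc hA hB α β 6) fun v => ?_
  rw [norm_mul, norm_pow]
  exact mul_le_mul_of_nonneg_left (norm_pow_six_le _) (norm_nonneg _)

theorem tsum_oddSign_eq {τ : ℂ} (hτ : 0 < τ.im) :
    ∑' v : ℤ × ℤ, oddSign 6 v.1 * oddSign 4 v.2 *
        Complex.exp (Real.pi * Complex.I * ((1 / 24 : ℝ) * v.1 ^ 2 + (1 / 8 : ℝ) * v.2 ^ 2) * τ) *
        ((v.1 + rootNegThree * v.2) / 2) ^ 6 = -2 * thetaSeven τ := by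
  set H : ℤ × ℤ → ℂ := fun v =>
    Complex.exp (Real.pi * Complex.I * ((1 / 24 : ℝ) * v.1 ^ 2 + (1 / 8 : ℝ) * v.2 ^ 2) * τ) *
        ((v.1 + rootNegThree * v.2) / 2) ^ 6 with hH
  set c : ℤ × ℤ → ℤ := fun v => oddSignInt 6 v.1 * oddSignInt 4 v.2 with hc
  have hsum : Summable fun v => (c v : ℂ) * H v := by
    have := summable_theta_pow_six hτ (c := fun v => oddSign 6 v.1 * oddSign 4 v.2)
      (K := 1) (fun v => by
        rw [norm_mul]
        exact mul_le_one₀ (norm_oddSign_le 6 v.1) (norm_nonneg _) (norm_oddSign_le 4 v.2))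
      (A := 1 / 24) (B := 1 / 8) (by norm_num) (by norm_num) (1 / 2) (rootNegThree / 2)
    refine this.congr fun v => ?_
    simp only [hc, hH, oddSign_eq]
    push_cast
    ring
  have hlhs : ∑' v : ℤ × ℤ, oddSign 6 v.1 * oddSign 4 v.2 *
        Complex.exp (Real.pi * Complex.I * ((1 / 24 : ℝ) * v.1 ^ 2 + (1 / 8 : ℝ) * v.2 ^ 2) * τ) *
        ((v.1 + rootNegThree * v.2) / 2) ^ 6 = ∑' v, (c v : ℂ) * H v := by
    refine tsum_congr fun v => ?_
    simp only [hc, hH, oddSign_eq, mul_assoc]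
    push_cast
    ring
  let g₁ : ℤ × ℤ → ℤ × ℤ := fun v => (-v.1 - 3 * v.2, v.1 - v.2)
  let g₂ : ℤ × ℤ → ℤ × ℤ := fun v => (-v.1 + 3 * v.2, -v.1 - v.2)
  have hg₁ : Function.Injective g₁ := by
    rintro ⟨a, b⟩ ⟨c, d⟩ h
    simp only [g₁, Prod.mk.injEq] at h ⊢
    omega
  have hg₂ : Function.Injective g₂ := by
    rintro ⟨a, b⟩ ⟨c, d⟩ h
    simp only [g₂, Prod.mk.injEq] at h ⊢
    omega
  have hsplit : ∀ v, (c v : ℂ) * H v =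
      Set.indicator (Set.range g₁) (fun v => (c v : ℂ) * H v) v +
      Set.indicator (Set.range g₂) (fun v => (c v : ℂ) * H v) v := by
    rintro ⟨x, y⟩
    have m₁ : (x, y) ∈ Set.range g₁ ↔ (x + y) % 4 = 0 := by
      constructor
      · rintro ⟨⟨a, b⟩, h⟩
        simp only [g₁, Prod.mk.injEq] at h
        omega
      · intro h
        refine ⟨(y - (x + y) / 4, -((x + y) / 4)), ?_⟩
        simp only [g₁, Prod.mk.injEq]
        omega
    have m₂ : (x, y) ∈ Set.range g₂ ↔ (x - y) % 4 = 0 := by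
      constructor
      · rintro ⟨⟨a, b⟩, h⟩
        simp only [g₂, Prod.mk.injEq] at h
        omega
      · intro h
        refine ⟨(-y - (x - y) / 4, (x - y) / 4), ?_⟩
        simp only [g₂, Prod.mk.injEq]
        omega
    by_cases hx : c (x, y) = 0
    · simp only [Set.indicator, hx, Int.cast_zero, zero_mul, ite_self, add_zero]
    · have hodd : x % 2 = 1 ∧ y % 2 = 1 := by
        by_contra hcon
        apply hx
        rcases (by omega : x % 2 = 0 ∨ y % 2 = 0) with h | h
        · have : oddSignInt 6 x = 0 := by
            rw [oddSignInt, if_neg (by omega), if_neg (by omega), sub_zero]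
          simp [hc, this]
        · have : oddSignInt 4 y = 0 := by
            rw [oddSignInt, if_neg (by omega), if_neg (by omega), sub_zero]
          simp [hc, this]
      rcases (by omega : ((x + y) % 4 = 0 ∧ (x - y) % 4 ≠ 0) ∨
        ((x + y) % 4 ≠ 0 ∧ (x - y) % 4 = 0)) with ⟨h1, h2⟩ | ⟨h1, h2⟩
      · rw [Set.indicator_of_mem (m₁.2 h1), Set.indicator_of_notMem (fun h => h2 (m₂.1 h)), add_zero]
      · rw [Set.indicator_of_notMem (fun h => h1 (m₁.1 h)), Set.indicator_of_mem (m₂.2 h2), zero_add]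
  have hω : ((-1 + rootNegThree) / 2) ^ 6 = 1 := by
    have h3 : ((-1 + rootNegThree) / 2) ^ 3 = 1 := by
      linear_combination ((rootNegThree - 3) / 8) * rootNegThree_sq
    rw [show (6 : ℕ) = 3 * 2 by norm_num, pow_mul, h3, one_pow]
  have hω' : ((-1 - rootNegThree) / 2) ^ 6 = 1 := by
    have h3 : ((-1 - rootNegThree) / 2) ^ 3 = 1 := by
      linear_combination ((-rootNegThree - 3) / 8) * rootNegThree_sq
    rw [show (6 : ℕ) = 3 * 2 by norm_num, pow_mul, h3, one_pow]
  have hH₁ (v : ℤ × ℤ) : H (g₁ v) = ((v.1 : ℂ) + v.2 * rootNegThree) ^ 6 *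
      Complex.exp (2 * Real.pi * Complex.I * τ * (normThree v / 12)) := by
    simp only [hH, g₁, normThree]
    rw [mul_comm, ← mul_one (((v.1 : ℂ) + v.2 * rootNegThree) ^ 6), ← hω, ← mul_pow]
    congr 2
    · push_cast
      linear_combination (-(v.2 : ℂ) / 2) * rootNegThree_sq
    · push_cast; ring
  have hH₂ (v : ℤ × ℤ) : H (g₂ v) = ((v.1 : ℂ) + v.2 * rootNegThree) ^ 6 *
      Complex.exp (2 * Real.pi * Complex.I * τ * (normThree v / 12)) := by
    simp only [hH, g₂, normThree]
    rw [mul_comm, ← mul_one (((v.1 : ℂ) + v.2 * rootNegThree) ^ 6), ← hω', ← mul_pow]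
    congr 2
    · push_cast
      linear_combination ((v.2 : ℂ) / 2) * rootNegThree_sq
    · push_cast; ring
  have hind {g : ℤ × ℤ → ℤ × ℤ} (hg : Function.Injective g) :
      ∑' v, Set.indicator (Set.range g) (fun v => (c v : ℂ) * H v) v =
        ∑' v, (c (g v) : ℂ) * H (g v) := by
    rw [← hg.tsum_eq (Set.support_indicator_subset)]
    exact tsum_congr fun v => Set.indicator_of_mem (Set.mem_range_self v) _
  have hs₁ : Summable fun v => (c (g₁ v) : ℂ) * H (g₁ v) := hsum.comp_injective hg₁
  have hs₂ : Summable fun v => (c (g₂ v) : ℂ) * H (g₂ v) := hsum.comp_injective hg₂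
  rw [hlhs, tsum_congr hsplit, Summable.tsum_add (hsum.indicator _) (hsum.indicator _),
    hind hg₁, hind hg₂, ← Summable.tsum_add hs₁ hs₂, thetaSeven, ← tsum_mul_left]
  refine tsum_congr fun v => ?_
  have h := oddSignInt_add v.1 v.2
  have h' := congrArg (fun z : ℤ => (z : ℂ)) h
  simp only [hH₁, hH₂, hc, g₁, g₂]
  push_cast at h' ⊢
  linear_combination (((v.1 : ℂ) + v.2 * rootNegThree) ^ 6 *
      Complex.exp (2 * Real.pi * Complex.I * τ * (normThree v / 12))) * h'

theorem thetaSeven_neg_inv {τ : ℂ} (hτ : 0 < τ.im) :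
    thetaSeven (-1 / τ) = Complex.I * τ ^ 7 * thetaSeven τ := by
  have hτ0 : τ ≠ 0 := by rintro rfl; simp at hτ
  have hσ : 0 < (-1 / τ).im := by
    rw [neg_div, one_div, Complex.neg_im, Complex.inv_im, neg_div, neg_neg]
    have := Complex.normSq_pos.2 hτ0
    positivity
  have h := tsum_theta_prod_pow_six hτ
  rw [tsum_sinCoeff_eq, tsum_oddSign_eq hσ] at h
  have h3 : (Real.sqrt 3 : ℂ) ≠ 0 := by
    rw [Complex.ofReal_ne_zero]; positivity
  have h4 : thetaSeven τ = -(Complex.I / τ ^ 7) * thetaSeven (-1 / τ) := by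
    have h5 : (2 * Real.sqrt 3 : ℂ) ≠ 0 := mul_ne_zero two_ne_zero h3
    apply mul_left_cancel₀ h5
    rw [h]; ring
  rw [h4]
  field_simp
  linear_combination (thetaSeven (-(1 / τ))) * Complex.I_sq

theorem evenChi_fin : ∀ x y : Fin 12,
    (evenChi ((x : ℕ) : ℤ) ((y : ℕ) : ℤ) ≠ 0 →
      (((x : ℕ) : ℤ) ^ 2 + 3 * ((y : ℕ) : ℤ) ^ 2) % 12 = 7) ∧
    ((((x : ℕ) : ℤ) ^ 2 + 3 * ((y : ℕ) : ℤ) ^ 2) % 12 = 7 → ((x : ℕ) : ℤ) % 2 = 0) := by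
  unfold evenChi heckeChi chiThree kappaFour
  decide +kernel

theorem normThree_emod (x y : ℤ) :
    normThree (x, y) % 12 = ((x % 12) ^ 2 + 3 * (y % 12) ^ 2) % 12 := by
  have h : normThree (x, y) ≡ (x % 12) ^ 2 + 3 * (y % 12) ^ 2 [ZMOD 12] :=
    ((Int.mod_modEq x 12).symm.pow 2).add (((Int.mod_modEq y 12).symm.pow 2).mul_left 3)
  exact h

theorem normThree_emod_of_evenChi_ne_zero {v : ℤ × ℤ} (h : evenChi v.1 v.2 ≠ 0) :
    normThree v % 12 = 7 := by
  obtain ⟨x, y⟩ := v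
  obtain ⟨r, hr⟩ := exists_fin_twelve x
  obtain ⟨t, ht⟩ := exists_fin_twelve y
  rw [normThree_emod, hr, ht]
  refine (evenChi_fin r t).1 fun h0 => h ?_
  rw [← hr, ← ht] at h0
  unfold evenChi at h0 ⊢
  rwa [heckeChi_mod, Int.emod_emod_of_dvd _ (by norm_num : (2 : ℤ) ∣ 12)] at h0

theorem evenChi_eq_heckeChi {v : ℤ × ℤ} (h : normThree v % 12 = 7) :
    evenChi v.1 v.2 = heckeChi v.1 v.2 := by
  obtain ⟨x, y⟩ := v
  obtain ⟨r, hr⟩ := exists_fin_twelve x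
  obtain ⟨t, ht⟩ := exists_fin_twelve y
  rw [normThree_emod, hr, ht] at h
  have := (evenChi_fin r t).2 h
  rw [← hr, Int.emod_emod_of_dvd _ (by norm_num : (2 : ℤ) ∣ 12)] at this
  simp [evenChi, this]

theorem summable_thetaSeven {τ : ℂ} (hτ : 0 < τ.im) : Summable fun v : ℤ × ℤ =>
    (evenChi v.1 v.2 : ℂ) * ((v.1 : ℂ) + v.2 * rootNegThree) ^ 6 *
      Complex.exp (2 * Real.pi * Complex.I * τ * ((normThree v : ℂ) / 12)) := by
  refine (summable_theta_pow_six hτ (c := fun v : ℤ × ℤ => (evenChi v.1 v.2 : ℂ)) (K := 1)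
    (fun v => norm_evenChi_le v.1 v.2) (A := 1 / 6) (B := 1 / 2) (by norm_num) (by norm_num)
    1 rootNegThree).congr fun v => ?_
  have : (Real.pi * Complex.I * (((1 / 6 : ℝ) : ℂ) * (v.1 : ℂ) ^ 2
      + ((1 / 2 : ℝ) : ℂ) * (v.2 : ℂ) ^ 2) * τ : ℂ) =
      2 * Real.pi * Complex.I * τ * ((normThree v : ℂ) / 12) := by
    simp only [normThree]
    push_cast
    ring
  rw [this]
  ring

theorem hasSum_thetaSeven {τ : ℂ} (hτ : 0 < τ.im) :
    HasSum (fun n : ℕ => heckeSum (12 * n + 7) *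
      Complex.exp (2 * Real.pi * Complex.I * τ * ((12 * n + 7 : ℂ) / 12))) (thetaSeven τ) := by
  have h := (summable_thetaSeven hτ).hasSum.tsum_fiberwise
    (fun v : ℤ × ℤ => ((normThree v - 7) / 12).toNat)
  refine h.congr_fun ?_
  intro n
  symm
  rw [tsum_subtype _ (fun v : ℤ × ℤ => (evenChi v.1 v.2 : ℂ) *
    ((v.1 : ℂ) + v.2 * rootNegThree) ^ 6 *
      Complex.exp (2 * Real.pi * Complex.I * τ * ((normThree v : ℂ) / 12))),
    tsum_eq_sum (s := reps (12 * n + 7)), heckeSum, Finset.sum_mul]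
  · refine Finset.sum_congr rfl fun v hv => ?_
    rw [mem_reps] at hv
    have hv' : normThree v = 12 * n + 7 := by exact_mod_cast hv
    rw [Set.indicator_of_mem, evenChi_eq_heckeChi (by omega), hv']
    · simp [heckePsi]
    · simp only [Set.mem_preimage, Set.mem_singleton_iff]
      omega
  · intro v hv
    rw [mem_reps] at hv
    push_cast at hv
    by_cases hc : evenChi v.1 v.2 = 0
    · simp [Set.indicator, hc]
    · rw [Set.indicator_of_notMem]
      have h7 := normThree_emod_of_evenChi_ne_zero hc
      have h0 : 0 ≤ normThree v := by unfold normThree; positivity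
      simp only [Set.mem_preimage, Set.mem_singleton_iff]
      omega

theorem hasFPowerSeriesOnBall_of_summable {b : ℕ → ℂ}
    (hb : ∀ q : ℂ, ‖q‖ < 1 → Summable fun n => b n * q ^ n) :
    HasFPowerSeriesOnBall (fun q : ℂ => ∑' n, b n * q ^ n)
      (FormalMultilinearSeries.ofScalars ℂ b) 0 1 := by
  constructor
  · refine le_of_forall_lt_imp_le_of_dense fun r hr => ?_
    lift r to NNReal using hr.ne_top
    apply FormalMultilinearSeries.le_radius_of_summable
    simpa [smul_eq_mul, norm_mul, mul_comm, mul_left_comm, mul_assoc] using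
      (hb r (by simpa using hr)).norm
  · simp
  · intro y hy
    rw [← ENNReal.coe_one, Metric.eball_coe, NNReal.coe_one, mem_ball_zero_iff] at hy
    simpa [mul_comm] using (hb y hy).hasSum

theorem iteratedDeriv_tsum_mul_pow {b : ℕ → ℂ}
    (hb : ∀ q : ℂ, ‖q‖ < 1 → Summable fun n => b n * q ^ n) (n : ℕ) :
    iteratedDeriv n (fun q : ℂ => ∑' n, b n * q ^ n) 0 = n.factorial * b n := by
  rw [iteratedDeriv_eq_iteratedFDeriv,
    ← (hasFPowerSeriesOnBall_of_summable hb).factorial_smul 1 n]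
  simp

theorem tendsto_iteratedDeriv_of_tendstoLocallyUniformlyOn {U : Set ℂ} (hU : IsOpen U)
    {F : ℕ → ℂ → ℂ} {g : ℂ → ℂ} (hF : ∀ N, Differentiable ℂ (F N))
    (h : TendstoLocallyUniformlyOn F g Filter.atTop U) (n : ℕ) :
    TendstoLocallyUniformlyOn (fun N => iteratedDeriv n (F N)) (iteratedDeriv n g)
      Filter.atTop U := by
  induction n with
  | zero => simpa using h
  | succ n ih =>
    simp only [iteratedDeriv_succ]
    exact ih.deriv (.of_forall fun N =>
      (ContDiff.differentiable_iteratedDeriv' n (hF N).contDiff).differentiableOn) hU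

theorem tendstoLocallyUniformlyOn_pow {U : Set ℂ} {F : ℕ → ℂ → ℂ} {g : ℂ → ℂ}
    (hg : ContinuousOn g U) (h : TendstoLocallyUniformlyOn F g Filter.atTop U) (k : ℕ) :
    TendstoLocallyUniformlyOn (fun N q => F N q ^ k) (fun q => g q ^ k) Filter.atTop U := by
  induction k with
  | zero =>
    simp only [pow_zero]
    exact TendstoUniformlyOn.tendstoLocallyUniformlyOn
      fun u hu => .of_forall fun _ _ _ => refl_mem_uniformity hu
  | succ k ih =>
    simp only [pow_succ]
    exact ih.fun_mul₀ h (hg.pow k) hg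

theorem iteratedDeriv_eval_zero (P : Polynomial ℂ) (n : ℕ) :
    iteratedDeriv n (fun q => P.eval q) 0 = n.factorial * P.coeff n := by
  have h : ∀ Q : Polynomial ℂ, iteratedDeriv n (fun q => Q.eval q) =
      fun q => ((Polynomial.derivative)^[n] Q).eval q := by
    induction n with
    | zero => simp
    | succ n ih =>
      intro Q
      rw [iteratedDeriv_succ', Function.iterate_succ_apply, ← ih]
      congr 1
      funext q
      exact Q.deriv
  rw [h]
  beta_reduce
  rw [← Polynomial.coeff_zero_eq_eval_zero, Polynomial.coeff_iterate_derivative]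
  simp [Nat.descFactorial_self]

theorem iteratedDeriv_tprod_pow {a : ℕ → ℤ} {k : ℕ}
    (ha : ∀ n N : ℕ, n ≤ N →
      a n = (((∏ m ∈ Finset.Icc 1 N, ((1 : Polynomial ℤ) - Polynomial.X ^ m)) ^ k).coeff n))
    (n : ℕ) :
    iteratedDeriv n (fun q : ℂ => (∏' m : ℕ, (1 - q ^ (m + 1))) ^ k) 0 = n.factorial * a n := by
  have h := tendstoLocallyUniformlyOn_pow
    ModularForm.differentiableOn_tprod_one_sub_pow.continuousOn
    (F := fun N q => ∏ m ∈ Finset.range N, (1 - q ^ (m + 1))) (by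
      intro v hv r hr
      obtain ⟨t, ht, htr⟩ := ModularForm.multipliableLocallyUniformlyOn_one_sub_pow.hasProdLocallyUniformlyOn v hv r hr
      exact ⟨t, ht, Filter.tendsto_finset_range.eventually htr⟩) k
  have h2 := (tendsto_iteratedDeriv_of_tendstoLocallyUniformlyOn Metric.isOpen_ball
    (fun N => by fun_prop) h n).tendsto_at (Metric.mem_ball_self one_pos)
  refine tendsto_nhds_unique h2 (tendsto_const_nhds.congr' ?_)
  filter_upwards [Filter.eventually_ge_atTop n] with N hN
  rw [ha n N hN]
  have := iteratedDeriv_eval_zero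
    (((∏ m ∈ Finset.Icc 1 N, ((1 : Polynomial ℤ) - Polynomial.X ^ m)) ^ k).map
      (Int.castRingHom ℂ)) n
  rw [Polynomial.coeff_map] at this
  simp only [eq_intCast] at this
  rw [← this]
  congr 1
  funext q
  rw [← Finset.Ico_add_one_right_eq_Icc, Finset.prod_Ico_eq_prod_range]
  simp [Polynomial.eval_prod, Polynomial.map_prod, Polynomial.map_pow, add_comm]

open Complex in
theorem hasSum_heckeSum_mul_qParam {τ : ℂ} (hτ : 0 < τ.im) :
    HasSum (fun n : ℕ => heckeSum (12 * n + 7) * Function.Periodic.qParam 1 τ ^ n)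
      (exp (-(2 * Real.pi * I * τ * (7 / 12))) * thetaSeven τ) := by
  refine ((hasSum_thetaSeven hτ).mul_left (exp (-(2 * Real.pi * I * τ * (7 / 12))))).congr_fun ?_
  intro n
  rw [Function.Periodic.qParam, ← exp_nat_mul, mul_left_comm, ← exp_add]
  congr 2
  push_cast
  ring

theorem summable_heckeSum_mul_pow {q : ℂ} (hq : ‖q‖ < 1) :
    Summable fun n : ℕ => heckeSum (12 * n + 7) * q ^ n := by
  rcases eq_or_ne q 0 with rfl | h0
  · exact summable_of_ne_finset_zero (s := {0}) fun n hn => by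
      simp [zero_pow (Finset.notMem_singleton.mp hn)]
  · have h := (hasSum_heckeSum_mul_qParam
      (Function.Periodic.im_invQParam_pos_of_norm_lt_one one_pos hq h0)).summable
    rwa [Function.Periodic.qParam_right_inv one_ne_zero h0] at h

/-- The generating function of the sums `heckeSum (12 n + 7)`. -/
noncomputable def heckeGen (q : ℂ) : ℂ := ∑' n : ℕ, heckeSum (12 * n + 7) * q ^ n

/-- The infinite product `∏ (1 - q ^ m) ^ 14`. -/
noncomputable def eulerFourteen (q : ℂ) : ℂ := (∏' m : ℕ, (1 - q ^ (m + 1))) ^ 14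

theorem differentiableOn_heckeGen : DifferentiableOn ℂ heckeGen (Metric.ball 0 1) := by
  have h := (hasFPowerSeriesOnBall_of_summable
    fun q hq => summable_heckeSum_mul_pow hq).differentiableOn
  rwa [← ENNReal.coe_one, Metric.eball_coe] at h

theorem differentiableOn_eulerFourteen : DifferentiableOn ℂ eulerFourteen (Metric.ball 0 1) :=
  ModularForm.differentiableOn_tprod_one_sub_pow.fun_pow 14

theorem eulerFourteen_ne_zero {q : ℂ} (hq : ‖q‖ < 1) : eulerFourteen q ≠ 0 := by
  refine pow_ne_zero _ ?_
  simp_rw [sub_eq_add_neg]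
  refine tprod_one_add_ne_zero_of_summable (fun n => ?_) ?_
  · rw [← sub_eq_add_neg, sub_ne_zero]
    intro h
    have h1 : ‖q ^ (n + 1)‖ < 1 := by
      rw [norm_pow]
      exact pow_lt_one₀ (norm_nonneg _) hq (Nat.succ_ne_zero n)
    rw [← h, norm_one] at h1
    exact lt_irrefl _ h1
  · simpa using (summable_nat_add_iff 1).mpr (summable_geometric_of_lt_one (norm_nonneg _) hq)

open Complex in
theorem eta_pow_fourteen (τ : ℂ) : ModularForm.eta τ ^ 14 =
    exp (2 * Real.pi * I * τ * (7 / 12)) * eulerFourteen (Function.Periodic.qParam 1 τ) := by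
  rw [ModularForm.eta, mul_pow, eulerFourteen, Function.Periodic.qParam, ← exp_nat_mul]
  congr 2
  push_cast
  ring

theorem heckeGen_div_eulerFourteen {τ : ℂ} (hτ : 0 < τ.im) :
    heckeGen (Function.Periodic.qParam 1 τ) / eulerFourteen (Function.Periodic.qParam 1 τ) =
      thetaSeven τ / ModularForm.eta τ ^ 14 := by
  rw [heckeGen, (hasSum_heckeSum_mul_qParam hτ).tsum_eq, eta_pow_fourteen, Complex.exp_neg]
  field_simp

open Complex in
theorem sqrt_pow_fourteen {z : ℂ} (hz : z ≠ 0) : sqrt z ^ 14 = z ^ 7 := by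
  rw [sqrt_eq_exp hz, ← exp_nat_mul, show ((14 : ℕ) : ℂ) * (log z / 2) = (7 : ℕ) * log z by
    push_cast; ring, exp_nat_mul, exp_log hz]

open Complex in
theorem eta_pow_fourteen_neg_inv {τ : ℂ} (hτ : 0 < τ.im) :
    ModularForm.eta (-1 / τ) ^ 14 = I * τ ^ 7 * ModularForm.eta τ ^ 14 := by
  have hτ0 : τ ≠ 0 := by
    rintro rfl
    simp at hτ
  have he : ModularForm.eta (-1 / τ) = (sqrt I)⁻¹ * (sqrt τ * ModularForm.eta τ) := by
    simpa using ModularForm.eta_comp_eq_csqrt_I_inv hτ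
  rw [he, mul_pow, mul_pow, inv_pow, sqrt_pow_fourteen I_ne_zero, sqrt_pow_fourteen hτ0]
  have : (I ^ 7)⁻¹ = I := by
    rw [show I ^ 7 = (I ^ 2) ^ 3 * I by ring, I_sq]
    norm_num
  rw [this, mul_assoc]

/-- The quotient of `thetaSeven` by the fourteenth power of the eta function. -/
noncomputable def thetaQuotient (τ : UpperHalfPlane) : ℂ :=
  thetaSeven τ / ModularForm.eta τ ^ 14

theorem thetaQuotient_eq (τ : UpperHalfPlane) : thetaQuotient τ =
    heckeGen (Function.Periodic.qParam 1 τ) / eulerFourteen (Function.Periodic.qParam 1 τ) :=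
  (heckeGen_div_eulerFourteen τ.2).symm

open MatrixGroups ModularForm in
theorem thetaQuotient_slash_T : thetaQuotient ∣[(0 : ℤ)] ModularGroup.T = thetaQuotient := by
  ext τ
  rw [SL_slash_apply, UpperHalfPlane.modular_T_smul, thetaQuotient_eq, thetaQuotient_eq]
  have : Function.Periodic.qParam 1 ((1 : ℝ) +ᵥ τ : UpperHalfPlane) =
      Function.Periodic.qParam 1 (τ : ℂ) := by
    rw [UpperHalfPlane.coe_vadd, add_comm]
    simp [Function.Periodic.qParam, mul_add, Complex.exp_add]
  rw [this]
  simp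

open MatrixGroups ModularForm in
theorem thetaQuotient_slash_S : thetaQuotient ∣[(0 : ℤ)] ModularGroup.S = thetaQuotient := by
  ext τ
  have hS : ((ModularGroup.S • τ : UpperHalfPlane) : ℂ) = -1 / (τ : ℂ) := by
    rw [UpperHalfPlane.modular_S_smul]
    simp [neg_div, inv_neg]
  have h0 := UpperHalfPlane.ne_zero τ
  have h1 := pow_ne_zero 14 (ModularForm.eta_ne_zero τ.2)
  rw [SL_slash_apply, thetaQuotient, thetaQuotient, hS, thetaSeven_neg_inv τ.2,
    eta_pow_fourteen_neg_inv τ.2, mul_div_mul_left _ _ (mul_ne_zero Complex.I_ne_zero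
      (pow_ne_zero 7 h0))]
  simp

theorem differentiableOn_heckeGen_div : DifferentiableOn ℂ
    (fun q => heckeGen q / eulerFourteen q) (Metric.ball 0 1) :=
  differentiableOn_heckeGen.fun_div differentiableOn_eulerFourteen
    fun q hq => eulerFourteen_ne_zero (by simpa using hq)

theorem isBoundedAtImInfty_thetaQuotient :
    UpperHalfPlane.IsBoundedAtImInfty thetaQuotient := by
  have h := ((differentiableOn_heckeGen_div.continuousOn.continuousAt
    (Metric.ball_mem_nhds 0 one_pos)).tendsto.comp
      (UpperHalfPlane.qParam_tendsto_atImInfty one_pos)).isBigO_one ℝ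
  refine Asymptotics.IsBigO.congr' h (.of_forall fun τ => ?_) (.of_forall fun _ => rfl)
  exact (thetaQuotient_eq τ).symm

open MatrixGroups ModularForm UpperHalfPlane in
/-- `thetaQuotient` as a modular form of weight zero and level one. -/
noncomputable def thetaQuotientForm : ModularForm 𝒮ℒ 0 where
  toFun := thetaQuotient
  slash_action_eq' A hA := by
    obtain ⟨A, rfl⟩ := hA
    exact SlashInvariantForm.slash_action_generators_SL2Z thetaQuotient_slash_S
      thetaQuotient_slash_T A
  holo' := by
    rw [UpperHalfPlane.mdifferentiable_iff]
    have h : DifferentiableOn ℂ ((fun q => heckeGen q / eulerFourteen q) ∘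
        Function.Periodic.qParam 1) {z | 0 < z.im} :=
      differentiableOn_heckeGen_div.comp
        (Function.Periodic.differentiable_qParam (h := 1)).differentiableOn fun z hz => by
          simpa using Function.Periodic.norm_qParam_lt_one one_pos hz
    refine h.congr fun z hz => ?_
    simp only [Function.comp_apply, ofComplex_apply_of_im_pos hz]
    exact thetaQuotient_eq ⟨z, hz⟩
  bdd_at_cusps' hc := by
    rw [Subgroup.IsArithmetic.isCusp_iff_isCusp_SL2Z] at hc
    rw [OnePoint.isBoundedAt_iff_forall_SL2Z hc]
    intro γ _
    rw [SlashInvariantForm.slash_action_generators_SL2Z thetaQuotient_slash_S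
      thetaQuotient_slash_T]
    exact isBoundedAtImInfty_thetaQuotient

theorem exists_heckeGen_eq : ∃ c : ℂ, ∀ q ∈ Metric.ball (0 : ℂ) 1, q ≠ 0 →
    heckeGen q = c * eulerFourteen q := by
  obtain ⟨c, hc⟩ := ModularFormClass.levelOne_weight_zero_const thetaQuotientForm
  refine ⟨c, fun q hq h0 => ?_⟩
  have hq1 : ‖q‖ < 1 := by simpa using hq
  have him := Function.Periodic.im_invQParam_pos_of_norm_lt_one one_pos hq1 h0
  have h := congrFun hc ⟨_, him⟩
  have h2 := thetaQuotient_eq ⟨_, him⟩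
  rw [UpperHalfPlane.coe_mk, Function.Periodic.qParam_right_inv one_ne_zero h0] at h2
  rw [← div_eq_iff (eulerFourteen_ne_zero hq1), ← h2]
  exact h

theorem heckeSum_eq_mul {a : ℕ → ℤ}
    (ha : ∀ n N : ℕ, n ≤ N →
      a n = (((∏ m ∈ Finset.Icc 1 N, ((1 : Polynomial ℤ) - Polynomial.X ^ m)) ^ 14).coeff n))
    (n : ℕ) : heckeSum (12 * n + 7) = heckeSum 7 * a n := by
  obtain ⟨c, hc⟩ := exists_heckeGen_eq
  have hball := Metric.ball_mem_nhds (0 : ℂ) one_pos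
  have hev : heckeGen =ᶠ[nhds 0] fun q => c * eulerFourteen q := by
    have h1 := differentiableOn_heckeGen.continuousOn.continuousAt hball
    have h2 := (differentiableOn_eulerFourteen.continuousOn.continuousAt hball).const_mul c
    refine (h1.eventuallyEq_nhds_iff_eventuallyEq_nhdsNE h2).mp ?_
    filter_upwards [self_mem_nhdsWithin, mem_nhdsWithin_of_mem_nhds hball] with q h0 hq
    exact hc q hq h0
  have key : ∀ n, heckeSum (12 * n + 7) = c * a n := by
    intro n
    have h := hev.iteratedDeriv_eq n
    have hE : iteratedDeriv n eulerFourteen 0 = n.factorial * a n := iteratedDeriv_tprod_pow ha n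
    have hH : iteratedDeriv n heckeGen 0 = n.factorial * heckeSum (12 * n + 7) :=
      iteratedDeriv_tsum_mul_pow (fun q hq => summable_heckeSum_mul_pow hq) n
    rw [hH, iteratedDeriv_const_mul_field, hE, mul_left_comm] at h
    exact mul_left_cancel₀ (Nat.cast_ne_zero.mpr n.factorial_ne_zero) h
  have ha0 : a 0 = 1 := by simpa using ha 0 0 le_rfl
  have h7 : heckeSum 7 = c := by simpa [ha0] using key 0
  rw [h7, key]

/-- Fourteenth power: with `a n` the coefficient of `q^n` in
`∏ (1 - q^m)^{14}`, and `f : ℕ → ℂ` the multiplicative function determined by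
the stated initial values and the recurrences
`f(p^r) = f(p) f(p^{r-1}) ± p^6 f(p^{r-2})` (`-` for `p ≡ 7 (mod 12)`, `+`
otherwise, per the paper's sign convention as stated), we have
`f (12 n + 7) = 360 √(-3) a_n` for all `n`; moreover for each prime
`p ≡ 1 (mod 3)` the representing pair `(x, y)` with `p = x² + 3y²` is
unique. -/
theorem stmt_18 (a : ℕ → ℤ)
    (ha : ∀ n N : ℕ, n ≤ N →
      a n = (((∏ m ∈ Finset.Icc 1 N, ((1 : Polynomial ℤ) - Polynomial.X ^ m)) ^ 14).coeff n))
    (f : ℕ → ℂ)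
    (hf1 : f 1 = 1)
    (hfmul : ∀ m n : ℕ, Nat.Coprime m n → f (m * n) = f m * f n)
    (hfa : ∀ p r : ℕ, p.Prime → 1 ≤ r → p % 12 = 5 → Even r →
      f (p ^ r) = (-1) ^ (r / 2) * (p : ℂ) ^ (3 * r))
    (hfb : ∀ p r : ℕ, p.Prime → 1 ≤ r → p % 12 = 11 → Even r →
      f (p ^ r) = (p : ℂ) ^ (3 * r))
    (hfc : ∀ p r : ℕ, p.Prime → 1 ≤ r → (p % 12 = 5 ∨ p % 12 = 11) → Odd r →
      f (p ^ r) = 0)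
    (hfd : ∀ r : ℕ, 1 ≤ r → f (2 ^ r) = 0 ∧ f (3 ^ r) = 0)
    (hfe : ∀ p x y : ℕ, p.Prime → p % 12 = 7 → 0 < x → 0 < y →
      p = x ^ 2 + 3 * y ^ 2 →
      f p = 12 * (-1) ^ ((p - 7) / 12) *
        (if (x % 6 = 2 ∧ y % 4 ≠ 1) ∨ (x % 6 ≠ 2 ∧ y % 4 = 1) then (-1 : ℂ) else 1) *
        x * y * ((x : ℂ) ^ 2 - (y : ℂ) ^ 2) * (9 * (y : ℂ) ^ 2 - (x : ℂ) ^ 2) *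
        Real.sqrt 3 * Complex.I)
    (hff : ∀ p r : ℕ, p.Prime → p % 12 = 7 → 2 ≤ r →
      f (p ^ r) = f p * f (p ^ (r - 1)) + (p : ℂ) ^ 6 * f (p ^ (r - 2)))
    (hfg : ∀ p x y : ℕ, p.Prime → p % 12 = 1 → 0 < x → 0 < y →
      p = x ^ 2 + 3 * y ^ 2 →
      f p = 2 *
        (if x % 12 = 5 ∨ x % 12 = 7 then ((-1 : ℂ)) ^ (y / 2) else (-1 : ℂ) ^ (y / 2 + 1)) *
        ((x : ℂ) ^ 2 - 3 * (y : ℂ) ^ 2) *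
        (6 * (x : ℂ) * y + (x : ℂ) ^ 2 - 3 * (y : ℂ) ^ 2) *
        (6 * (x : ℂ) * y + 3 * (y : ℂ) ^ 2 - (x : ℂ) ^ 2))
    (hfh : ∀ p r : ℕ, p.Prime → p % 12 = 1 → 2 ≤ r →
      f (p ^ r) = f p * f (p ^ (r - 1)) - (p : ℂ) ^ 6 * f (p ^ (r - 2))) :
    (∀ p : ℕ, p.Prime → p % 3 = 1 →
      ∃! xy : ℕ × ℕ, 0 < xy.1 ∧ 0 < xy.2 ∧ p = xy.1 ^ 2 + 3 * xy.2 ^ 2) ∧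
    ∀ n : ℕ, f (12 * n + 7) = 360 * Real.sqrt 3 * Complex.I * (a n : ℂ) := by
  refine ⟨fun p hp h1 => existsUnique_eq_sq_add_three_sq hp h1, fun n => ?_⟩
  have hsum := heckeSum_eq_two_mul_of_values hf1 hfmul hfa hfb hfc hfe hff hfg hfh
  have h7 : f 7 = 360 * Real.sqrt 3 * Complex.I := by
    rw [hfe 7 2 1 (by norm_num) (by norm_num) (by norm_num) (by norm_num) (by norm_num)]
    norm_num
  have h := heckeSum_eq_mul ha n
  rw [hsum (12 * n + 7) (by omega) (by omega), hsum 7 (by norm_num) (by norm_num), h7] at h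
  linear_combination h / 2
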